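/- arXiv:1505.04895 — 10 statements merged into one kernel-verified Lean document; each statement's English description precedes it below -/
import Mathlib

section
/- Let f ∈ L¹_loc(ℝ) and define, for λ > 0, (Sf)(λ) = (1/π) ∫₀^{√λ} f(ν) (λ − ν²)^{−1/2} dν (the inner integral is absolutely convergent for almost every λ > 0, so Sf ∈ L¹_loc((0,∞))). If 0 is a right Lebesgue point of f with value α (i.e. lim_{h↓0} (1/h)∫₀^{h} |f(y) − α| dy = 0), then 0 is a right Lebesgue point of Sf with value α/2, that is, lim_{h↓0} (1/h) ∫₀^{h} |(Sf)(λ) − α/2| dλ = 0. -/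
open MeasureTheory Filter Topology Set

/-- The arcsine integral on `(0, √t]`, together with its convergence. -/
lemma integrableOn_inv_sqrt_sub_sq_and_integral_eq {t : ℝ} (ht : 0 < t) :
    IntegrableOn (fun ν => (Real.sqrt (t - ν ^ 2))⁻¹) (Ioc 0 (Real.sqrt t)) ∧
      ∫ ν in (0:ℝ)..Real.sqrt t, (Real.sqrt (t - ν ^ 2))⁻¹ = Real.pi / 2 := by
  have hs : 0 < Real.sqrt t := Real.sqrt_pos.2 ht
  have hcont : ContinuousOn (fun ν => Real.arcsin (ν / Real.sqrt t)) (Icc 0 (Real.sqrt t)) := by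
    fun_prop
  have hderiv : ∀ ν ∈ Ioo 0 (Real.sqrt t),
      HasDerivAt (fun ν => Real.arcsin (ν / Real.sqrt t)) (Real.sqrt (t - ν ^ 2))⁻¹ ν := by
    intro ν hν
    have h1 : ν / Real.sqrt t < 1 := (div_lt_one hs).2 hν.2
    have h0 : 0 < ν / Real.sqrt t := div_pos hν.1 hs
    have h := (Real.hasDerivAt_arcsin (x := ν / Real.sqrt t) (by linarith) h1.ne).comp ν
      ((hasDerivAt_id ν).div_const (Real.sqrt t))
    refine h.congr_deriv ?_
    have hfactor : t - ν ^ 2 = t * (1 - (ν / Real.sqrt t) ^ 2) := by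
      rw [div_pow, Real.sq_sqrt ht.le]
      field_simp
    rw [hfactor, Real.sqrt_mul ht.le, mul_inv]
    ring
  have hint : IntegrableOn (fun ν => (Real.sqrt (t - ν ^ 2))⁻¹) (Ioc 0 (Real.sqrt t)) :=
    intervalIntegral.integrableOn_deriv_of_nonneg hcont hderiv
      fun ν _ => inv_nonneg.2 (Real.sqrt_nonneg _)
  refine ⟨hint, ?_⟩
  rw [intervalIntegral.integral_eq_sub_of_hasDerivAt_of_le hs.le hcont hderiv
    ((intervalIntegrable_iff_integrableOn_Ioc_of_le hs.le).2 hint)]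
  simp [div_self hs.ne']

lemma lintegral_inv_sqrt_Ioc {h : ℝ} (hh : 0 ≤ h) :
    ∫⁻ x in Ioc 0 h, ENNReal.ofReal (Real.sqrt x)⁻¹ = ENNReal.ofReal (2 * Real.sqrt h) := by
  have heq : ∀ x ∈ Ioc 0 h, (Real.sqrt x)⁻¹ = x ^ (-(1 / 2) : ℝ) := fun x hx => by
    rw [Real.rpow_neg hx.1.le, Real.sqrt_eq_rpow]
  have hint : IntegrableOn (fun x : ℝ => x ^ (-(1 / 2) : ℝ)) (Ioc 0 h) :=
    (intervalIntegrable_iff_integrableOn_Ioc_of_le hh).1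
      (intervalIntegral.intervalIntegrable_rpow' (by norm_num))
  rw [setLIntegral_congr_fun measurableSet_Ioc fun x hx => by rw [heq x hx],
    ← ofReal_integral_eq_lintegral_ofReal hint, ← intervalIntegral.integral_of_le hh,
    integral_rpow (Or.inl (by norm_num))]
  · congr 1
    rw [Real.sqrt_eq_rpow]
    norm_num
    ring
  · filter_upwards [ae_restrict_mem measurableSet_Ioc] with x hx
    exact Real.rpow_nonneg hx.1.le _

lemma lintegral_inv_sqrt_sub_le {h c : ℝ} (hh : 0 ≤ h) (hc : 0 ≤ c) :
    ∫⁻ x in Ioc 0 h, ENNReal.ofReal (Real.sqrt (x - c))⁻¹ ≤ ENNReal.ofReal (2 * Real.sqrt h) := by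
  rw [← lintegral_inv_sqrt_Ioc hh, ← lintegral_indicator measurableSet_Ioc,
    ← lintegral_indicator measurableSet_Ioc,
    ← lintegral_sub_right_eq_self
      (indicator (Ioc 0 h) fun x : ℝ => ENNReal.ofReal (Real.sqrt x)⁻¹) c]
  refine lintegral_mono fun x => ?_
  by_cases hx : x ∈ Ioc 0 h
  · by_cases hxc : x - c ∈ Ioc 0 h
    · simp [hx, hxc]
    · have : x - c ≤ 0 := by
        by_contra! hlt
        exact hxc ⟨hlt, by linarith [hx.2]⟩
      rw [indicator_of_mem hx]
      simp [Real.sqrt_eq_zero_of_nonpos this]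
  · simp [hx]

lemma aemeasurable_abel_kernel {g : ℝ → ℝ} {μ ν : Measure ℝ} [SFinite ν]
    (hg : AEMeasurable g ν) :
    AEMeasurable (fun p : ℝ × ℝ =>
      ENNReal.ofReal |g p.2| * ENNReal.ofReal (Real.sqrt (p.1 - p.2 ^ 2))⁻¹) (μ.prod ν) := by
  have hk : Measurable fun p : ℝ × ℝ => ENNReal.ofReal (Real.sqrt (p.1 - p.2 ^ 2))⁻¹ := by
    fun_prop
  refine AEMeasurable.mul ?_ hk.aemeasurable
  have : AEMeasurable (fun p : ℝ × ℝ => g p.2) (μ.prod ν) := hg.comp_snd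
  exact (measurable_norm.comp_aemeasurable this).ennreal_ofReal

/-- Tonelli bound for the Abel-type kernel. The kernel vanishes for `ν ^ 2 ≥ x` by the conventions
for `√` and `⁻¹`, so the inner domain may be taken independent of `x`. -/
lemma lintegral_lintegral_abel_kernel_le {g : ℝ → ℝ} {h : ℝ} (hh : 0 ≤ h) {s : Set ℝ}
    (hg : AEMeasurable g (volume.restrict s)) :
    ∫⁻ x in Ioc 0 h, ∫⁻ ν in s,
        ENNReal.ofReal |g ν| * ENNReal.ofReal (Real.sqrt (x - ν ^ 2))⁻¹ ≤
      ENNReal.ofReal (2 * Real.sqrt h) * ∫⁻ ν in s, ENNReal.ofReal |g ν| := by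
  rw [lintegral_lintegral_swap (aemeasurable_abel_kernel hg),
    ← lintegral_const_mul' _ _ ENNReal.ofReal_ne_top]
  refine lintegral_mono fun ν => ?_
  rw [lintegral_const_mul' _ _ ENNReal.ofReal_ne_top, mul_comm]
  gcongr
  exact lintegral_inv_sqrt_sub_le hh (sq_nonneg ν)

lemma ae_integrableOn_div_sqrt_sub_sq {f : ℝ → ℝ} (hf : LocallyIntegrable f) :
    ∀ᵐ x ∂(volume.restrict (Ioi (0:ℝ))),
      IntegrableOn (fun ν => f ν / Real.sqrt (x - ν ^ 2)) (Ioc 0 (Real.sqrt x)) := by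
  have hU : Ioi (0:ℝ) = ⋃ n : ℕ, Ioc (0:ℝ) n := by
    ext x
    simp only [mem_Ioi, mem_iUnion, mem_Ioc]
    exact ⟨fun hx => (exists_nat_ge x).imp fun n hn => ⟨hx, hn⟩, fun ⟨_, hx, _⟩ => hx⟩
  rw [hU, ae_restrict_iUnion_iff]
  intro n
  have hint : IntegrableOn f (Ioc 0 (Real.sqrt n)) :=
    (hf.integrableOn_isCompact isCompact_Icc).mono_set Ioc_subset_Icc_self
  have hfin : ∫⁻ ν in Ioc 0 (Real.sqrt n), ENNReal.ofReal |f ν| < ⊤ :=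
    (hasFiniteIntegral_iff_norm f).1 hint.2
  have hlt := (lintegral_lintegral_abel_kernel_le (Nat.cast_nonneg n) hint.aemeasurable).trans_lt
    (ENNReal.mul_lt_top ENNReal.ofReal_lt_top hfin)
  have hmeas := (aemeasurable_abel_kernel (μ := volume.restrict (Ioc 0 (n:ℝ)))
    hint.aemeasurable).lintegral_prod_right'
  filter_upwards [ae_lt_top' hmeas hlt.ne, ae_restrict_mem measurableSet_Ioc] with x hx hxn
  have : IntegrableOn (fun ν => f ν / Real.sqrt (x - ν ^ 2)) (Ioc 0 (Real.sqrt n)) := by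
    refine ⟨(hint.aemeasurable.div (by fun_prop)).aestronglyMeasurable, ?_⟩
    rw [hasFiniteIntegral_iff_norm]
    refine lt_of_eq_of_lt (lintegral_congr fun ν => ?_) hx
    rw [← ENNReal.ofReal_mul (abs_nonneg _), Real.norm_eq_abs, abs_div,
      abs_of_nonneg (Real.sqrt_nonneg _), div_eq_mul_inv]
  exact this.mono_set (Ioc_subset_Ioc_right (Real.sqrt_le_sqrt hxn.2))

/-- Pointwise bound of `Sf - α / 2` by the Abel-type transform of `|f - α|`. -/
lemma ofReal_abs_abel_sub_le {f : ℝ → ℝ} {x h α : ℝ} (hx : 0 < x) (hxh : x ≤ h)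
    (hint : IntegrableOn (fun ν => f ν / Real.sqrt (x - ν ^ 2)) (Ioc 0 (Real.sqrt x))) :
    ENNReal.ofReal |(1 / Real.pi) * (∫ ν in (0:ℝ)..Real.sqrt x, f ν / Real.sqrt (x - ν ^ 2))
        - α / 2| ≤
      ENNReal.ofReal (1 / Real.pi) * ∫⁻ ν in Ioc 0 (Real.sqrt h),
        ENNReal.ofReal |f ν - α| * ENNReal.ofReal (Real.sqrt (x - ν ^ 2))⁻¹ := by
  obtain ⟨hk, hkval⟩ := integrableOn_inv_sqrt_sub_sq_and_integral_eq hx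
  have hs := Real.sqrt_nonneg x
  have hsub : (1 / Real.pi) * (∫ ν in (0:ℝ)..Real.sqrt x, f ν / Real.sqrt (x - ν ^ 2)) - α / 2 =
      (1 / Real.pi) * ∫ ν in Ioc 0 (Real.sqrt x), (f ν - α) * (Real.sqrt (x - ν ^ 2))⁻¹ := by
    have h1 : ∫ ν in Ioc 0 (Real.sqrt x), (f ν - α) * (Real.sqrt (x - ν ^ 2))⁻¹ =
        (∫ ν in Ioc 0 (Real.sqrt x), f ν / Real.sqrt (x - ν ^ 2)) -
          ∫ ν in Ioc 0 (Real.sqrt x), α * (Real.sqrt (x - ν ^ 2))⁻¹ := by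
      rw [← integral_sub hint (hk.const_mul α)]
      refine integral_congr_ae (.of_forall fun ν => ?_)
      simp only
      ring
    rw [h1, integral_const_mul, ← intervalIntegral.integral_of_le hs,
      ← intervalIntegral.integral_of_le hs, hkval]
    field_simp [Real.pi_ne_zero]
  have hpi : 0 ≤ 1 / Real.pi := by positivity
  rw [hsub, abs_mul, abs_of_nonneg hpi, ENNReal.ofReal_mul hpi]
  gcongr
  calc ENNReal.ofReal |∫ ν in Ioc 0 (Real.sqrt x), (f ν - α) * (Real.sqrt (x - ν ^ 2))⁻¹|
      ≤ ∫⁻ ν in Ioc 0 (Real.sqrt x), ENNReal.ofReal ‖(f ν - α) * (Real.sqrt (x - ν ^ 2))⁻¹‖ :=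
        by
        rw [← Real.norm_eq_abs]
        exact ENNReal.ofReal_le_of_le_toReal (norm_integral_le_lintegral_norm _)
    _ ≤ ∫⁻ ν in Ioc 0 (Real.sqrt h), ENNReal.ofReal ‖(f ν - α) * (Real.sqrt (x - ν ^ 2))⁻¹‖ :=
        lintegral_mono_set (Ioc_subset_Ioc_right (Real.sqrt_le_sqrt hxh))
    _ = _ := lintegral_congr fun ν => by
        rw [← ENNReal.ofReal_mul (abs_nonneg _), norm_mul, Real.norm_eq_abs, Real.norm_eq_abs,
          abs_of_nonneg (inv_nonneg.2 (Real.sqrt_nonneg _))]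

lemma integral_abs_abel_sub_le {f : ℝ → ℝ} (hf : LocallyIntegrable f) (α : ℝ) {h : ℝ}
    (hh : 0 ≤ h) :
    ∫ x in (0:ℝ)..h,
        |(1 / Real.pi) * (∫ ν in (0:ℝ)..Real.sqrt x, f ν / Real.sqrt (x - ν ^ 2)) - α / 2| ≤
      (1 / Real.pi) * (2 * Real.sqrt h * ∫ ν in (0:ℝ)..Real.sqrt h, |f ν - α|) := by
  have hint : IntegrableOn (fun ν => f ν - α) (Ioc 0 (Real.sqrt h)) :=
    ((hf.sub (locallyIntegrable_const α)).integrableOn_isCompact isCompact_Icc).mono_set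
      Ioc_subset_Icc_self
  have hnonneg : 0 ≤ ∫ ν in Ioc 0 (Real.sqrt h), |f ν - α| :=
    integral_nonneg fun ν => abs_nonneg _
  rw [intervalIntegral.integral_of_le hh, intervalIntegral.integral_of_le (Real.sqrt_nonneg h)]
  refine (Real.le_norm_self _).trans ((norm_integral_le_lintegral_norm _).trans
    (ENNReal.toReal_le_of_le_ofReal (by positivity) ?_))
  have hae := ae_restrict_of_ae_restrict_of_subset (show Ioc 0 h ⊆ Ioi 0 from fun x hx => hx.1)
    (ae_integrableOn_div_sqrt_sub_sq hf)
  calc _ ≤ ∫⁻ x in Ioc 0 h, ENNReal.ofReal (1 / Real.pi) * ∫⁻ ν in Ioc 0 (Real.sqrt h),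
        ENNReal.ofReal |f ν - α| * ENNReal.ofReal (Real.sqrt (x - ν ^ 2))⁻¹ := by
        refine lintegral_mono_ae ?_
        filter_upwards [hae, ae_restrict_mem measurableSet_Ioc] with x hx hxh
        rw [Real.norm_eq_abs, abs_abs]
        exact ofReal_abs_abel_sub_le hxh.1 hxh.2 hx
    _ ≤ ENNReal.ofReal (1 / Real.pi) * (ENNReal.ofReal (2 * Real.sqrt h) *
        ∫⁻ ν in Ioc 0 (Real.sqrt h), ENNReal.ofReal |f ν - α|) := by
        rw [lintegral_const_mul' _ _ ENNReal.ofReal_ne_top]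
        gcongr
        exact lintegral_lintegral_abel_kernel_le hh hint.aemeasurable
    _ = _ := by
        rw [← ofReal_integral_eq_lintegral_ofReal hint.abs (.of_forall fun ν => abs_nonneg _),
          ← ENNReal.ofReal_mul (by positivity), ← ENNReal.ofReal_mul (by positivity)]

/-- Lemma 4.1 of the paper. If `0` is a right Lebesgue point of a
locally integrable `f` with value `α`, then `0` is a right Lebesgue point of the
Abel-type transform `(Sf)(λ) = (1/π) ∫₀^{√λ} f(ν) (λ − ν²)^{-1/2} dν` with value `α/2`. -/
theorem statement0 (f : ℝ → ℝ) (hf : LocallyIntegrable f) (α : ℝ)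
    (hα : Tendsto (fun h : ℝ => (1 / h) * ∫ y in (0:ℝ)..h, |f y - α|) (𝓝[>] 0) (𝓝 0)) :
    (∀ᵐ lam ∂(volume.restrict (Set.Ioi (0:ℝ))),
        IntegrableOn (fun ν => f ν / Real.sqrt (lam - ν ^ 2)) (Set.Ioo 0 (Real.sqrt lam))) ∧
    Tendsto (fun h : ℝ => (1 / h) *
        ∫ lam in (0:ℝ)..h,
          |(1 / Real.pi) * (∫ ν in (0:ℝ)..Real.sqrt lam, f ν / Real.sqrt (lam - ν ^ 2)) - α / 2|)
      (𝓝[>] 0) (𝓝 0) := by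
  refine ⟨(ae_integrableOn_div_sqrt_sub_sq hf).mono fun x hx => hx.mono_set Ioo_subset_Ioc_self,
    ?_⟩
  have hsqrt : Tendsto Real.sqrt (𝓝[>] 0) (𝓝[>] 0) := by
    refine tendsto_nhdsWithin_iff.2 ⟨?_, ?_⟩
    · simpa using (Real.continuous_sqrt.tendsto 0).mono_left nhdsWithin_le_nhds
    · filter_upwards [self_mem_nhdsWithin] with x hx using Real.sqrt_pos.2 hx
  have hlim := (hα.comp hsqrt).const_mul (2 / Real.pi)
  rw [mul_zero] at hlim
  refine tendsto_of_tendsto_of_tendsto_of_le_of_le' tendsto_const_nhds hlim ?_ ?_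
  · filter_upwards [self_mem_nhdsWithin] with h hh
    have hh0 : (0:ℝ) ≤ h := le_of_lt hh
    exact mul_nonneg (by positivity)
      (intervalIntegral.integral_nonneg hh0 fun x _ => abs_nonneg _)
  · filter_upwards [self_mem_nhdsWithin] with h hh
    have hh0 : (0:ℝ) < h := hh
    have hs : 0 < Real.sqrt h := Real.sqrt_pos.2 hh0
    refine (mul_le_mul_of_nonneg_left (integral_abs_abel_sub_le hf α hh0.le)
      (by positivity)).trans_eq ?_
    have hdiv : 1 / h * Real.sqrt h = 1 / Real.sqrt h := by
      rw [one_div_mul_eq_div, Real.sqrt_div_self', one_div]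
    simp only [Function.comp_apply]
    rw [← hdiv]
    ring
end

section
/- Let f : ℝ → ℝ be measurable with ∫_ℝ |f(ν)| (1 + ν²)^{−3/2} dν < ∞. Then for every real z < 0 the integral (Tf)(z) := (−z) ∫_ℝ f(ν) (ν² − z)^{−3/2} dν is absolutely convergent. If 0 is a right Lebesgue point of f with value α₊ and a left Lebesgue point of f with value α₋, then lim_{z→0, z<0} (Tf)(z) = α₊ + α₋. -/
open MeasureTheory Filter Topology Set

theorem setLIntegral_le_mul_volume_of_lower {g : ℝ → ℝ} (hg0 : ∀ x, 0 ≤ g x)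
    {δ ε : ℝ} (hε : 0 ≤ ε) (hint : IntegrableOn g (Ioc 0 δ))
    (hG : ∀ r ∈ Ioc 0 δ, ∫ x in (0:ℝ)..r, g x ≤ ε * r) {S : Set ℝ} (hS : S ⊆ Ioc 0 δ)
    (hlow : ∀ x ∈ S, ∀ y, 0 < y → y ≤ x → y ∈ S) :
    ∫⁻ x in S, ENNReal.ofReal (g x) ≤ ENNReal.ofReal ε * volume S := by
  rcases S.eq_empty_or_nonempty with rfl | ⟨a, ha⟩
  · simp
  have hbdd : BddAbove S := ⟨δ, fun x hx => (hS hx).2⟩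
  have hr : sSup S ∈ Ioc 0 δ :=
    ⟨(hS ha).1.trans_le (le_csSup hbdd ha), csSup_le ⟨a, ha⟩ fun x hx => (hS hx).2⟩
  calc ∫⁻ x in S, ENNReal.ofReal (g x)
      ≤ ∫⁻ x in Ioc 0 (sSup S), ENNReal.ofReal (g x) :=
        lintegral_mono_set fun x hx => ⟨(hS hx).1, le_csSup hbdd hx⟩
    _ = ENNReal.ofReal (∫ x in (0:ℝ)..sSup S, g x) := by
        rw [intervalIntegral.integral_of_le hr.1.le, ofReal_integral_eq_lintegral_ofReal
          (hint.mono_set (Ioc_subset_Ioc_right hr.2)) (ae_of_all _ hg0)]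
    _ ≤ ENNReal.ofReal (ε * sSup S) := ENNReal.ofReal_le_ofReal (hG _ hr)
    _ = ENNReal.ofReal ε * volume (Ioo 0 (sSup S)) := by
        rw [ENNReal.ofReal_mul hε, Real.volume_Ioo, sub_zero]
    _ ≤ ENNReal.ofReal ε * volume S := by
        gcongr
        rintro y ⟨hy0, hy⟩
        obtain ⟨x, hx, hyx⟩ := exists_lt_of_lt_csSup ⟨a, ha⟩ hy
        exact hlow x hx y hy0 hyx.le

theorem setIntegral_mul_le_of_antitoneOn {g k : ℝ → ℝ} (hg : Measurable g) (hg0 : ∀ x, 0 ≤ g x)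
    (hk : Measurable k) (hk0 : ∀ x, 0 ≤ k x) (hanti : AntitoneOn k (Ioi 0))
    {δ ε : ℝ} (hε : 0 ≤ ε) (hint : IntegrableOn g (Ioc 0 δ))
    (hG : ∀ r ∈ Ioc 0 δ, ∫ x in (0:ℝ)..r, g x ≤ ε * r)
    (hkint : IntegrableOn k (Ioc 0 δ)) (hgk : IntegrableOn (fun x => g x * k x) (Ioc 0 δ)) :
    ∫ x in Ioc 0 δ, g x * k x ≤ ε * ∫ x in Ioc 0 δ, k x := by
  have hgm : Measurable fun x => ENNReal.ofReal (g x) := hg.ennreal_ofReal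
  have key : ∫⁻ x in Ioc 0 δ, ENNReal.ofReal (g x * k x)
      ≤ ENNReal.ofReal ε * ∫⁻ x in Ioc 0 δ, ENNReal.ofReal (k x) := by
    calc ∫⁻ x in Ioc 0 δ, ENNReal.ofReal (g x * k x)
        = ∫⁻ x, ENNReal.ofReal (k x)
            ∂((volume.restrict (Ioc 0 δ)).withDensity fun x => ENNReal.ofReal (g x)) := by
          rw [lintegral_withDensity_eq_lintegral_mul _ hgm hk.ennreal_ofReal]
          simp_rw [Pi.mul_apply, ENNReal.ofReal_mul (hg0 _)]
      _ ≤ ENNReal.ofReal ε * ∫⁻ x in Ioc 0 δ, ENNReal.ofReal (k x) := by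
          rw [lintegral_eq_lintegral_meas_lt _ (ae_of_all _ hk0) hk.aemeasurable,
            lintegral_eq_lintegral_meas_lt _ (ae_of_all _ hk0) hk.aemeasurable,
            ← lintegral_const_mul' _ _ ENNReal.ofReal_ne_top]
          refine lintegral_mono fun t => ?_
          have hm : MeasurableSet {a | t < k a} := measurableSet_lt measurable_const hk
          rw [withDensity_apply _ hm, Measure.restrict_apply hm, Measure.restrict_restrict hm]
          refine setLIntegral_le_mul_volume_of_lower hg0 hε hint hG inter_subset_right ?_
          rintro x ⟨hx, hx0, hxδ⟩ y hy hyx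
          exact ⟨lt_of_lt_of_le hx (hanti hy hx0 hyx), hy, hyx.trans hxδ⟩
  rw [← ofReal_integral_eq_lintegral_ofReal hgk
      (ae_of_all _ fun x => mul_nonneg (hg0 x) (hk0 x)),
    ← ofReal_integral_eq_lintegral_ofReal hkint (ae_of_all _ hk0), ← ENNReal.ofReal_mul hε] at key
  exact (ENNReal.ofReal_le_ofReal_iff
    (mul_nonneg hε (integral_nonneg hk0))).1 key

theorem hasDerivAt_mul_rpow_neg_half {z : ℝ} (hz : z < 0) (x : ℝ) :
    HasDerivAt (fun x : ℝ => x * (x ^ 2 - z) ^ (-(1/2) : ℝ))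
      (-z * (x ^ 2 - z) ^ (-(3/2) : ℝ)) x := by
  have hp : 0 < x ^ 2 - z := by nlinarith [sq_nonneg x]
  have h := (hasDerivAt_id x).mul
    ((((hasDerivAt_id x).pow 2).sub_const z).rpow_const (p := (-(1/2) : ℝ)) (Or.inl hp.ne'))
  refine h.congr_deriv ?_
  have e : (x ^ 2 - z) ^ (-(1/2) : ℝ) = (x ^ 2 - z) * (x ^ 2 - z) ^ (-(3/2) : ℝ) := by
    rw [← Real.rpow_one_add' hp.le (by norm_num)]; norm_num
  norm_num at e ⊢
  rw [e]; ring

theorem tendsto_mul_rpow_neg_half_atTop (z : ℝ) :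
    Tendsto (fun x : ℝ => x * (x ^ 2 - z) ^ (-(1/2) : ℝ)) atTop (𝓝 1) := by
  have h1 : Tendsto (fun x : ℝ => 1 - z * (x⁻¹) ^ 2) atTop (𝓝 (1 - z * 0 ^ 2)) :=
    ((tendsto_inv_atTop_zero.pow 2).const_mul z).const_sub 1
  have h2 := h1.rpow_const (p := (-(1/2) : ℝ)) (Or.inl (by norm_num))
  norm_num at h2
  refine h2.congr' ?_
  have h3 : ∀ᶠ x : ℝ in atTop, 0 < 1 - z * (x⁻¹) ^ 2 :=
    h1.eventually (lt_mem_nhds (by norm_num))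
  filter_upwards [h3, eventually_gt_atTop 0] with x hx hx0
  have e : x ^ 2 - z = x ^ 2 * (1 - z * (x⁻¹) ^ 2) := by field_simp
  rw [e, Real.mul_rpow (by positivity) hx.le, ← Real.rpow_natCast x 2, ← Real.rpow_mul hx0.le]
  norm_num [Real.rpow_neg_one]
  field_simp

theorem integrableOn_kernel {z : ℝ} (hz : z < 0) :
    IntegrableOn (fun x : ℝ => (x ^ 2 - z) ^ (-(3/2) : ℝ)) (Ioi 0) := by
  have h := integrableOn_Ioi_deriv_of_nonneg' (a := 0)
    (fun x _ => hasDerivAt_mul_rpow_neg_half hz x)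
    (fun x _ => mul_nonneg (neg_nonneg.2 hz.le)
      (Real.rpow_nonneg (by nlinarith [sq_nonneg x]) _)) (tendsto_mul_rpow_neg_half_atTop z)
  refine (h.const_mul (-z)⁻¹).congr (ae_of_all _ fun x => ?_)
  simp [inv_mul_cancel_left₀ hz.ne]

theorem neg_mul_setIntegral_kernel {z : ℝ} (hz : z < 0) :
    -z * ∫ x in Ioi (0:ℝ), (x ^ 2 - z) ^ (-(3/2) : ℝ) = 1 := by
  rw [← integral_const_mul, integral_Ioi_of_hasDerivAt_of_nonneg' (a := 0)
    (fun x _ => hasDerivAt_mul_rpow_neg_half hz x)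
    (fun x _ => mul_nonneg (neg_nonneg.2 hz.le)
      (Real.rpow_nonneg (by nlinarith [sq_nonneg x]) _)) (tendsto_mul_rpow_neg_half_atTop z)]
  simp

theorem kernel_le {c z x : ℝ} (hc : 0 < c) (h : c * (1 + x ^ 2) ≤ x ^ 2 - z) :
    (x ^ 2 - z) ^ (-(3/2) : ℝ) ≤ c ^ (-(3/2) : ℝ) * (1 + x ^ 2) ^ (-(3/2) : ℝ) := by
  rw [← Real.mul_rpow hc.le (by positivity)]
  exact Real.rpow_le_rpow_of_nonpos (by positivity) h (by norm_num)

theorem integrable_mul_kernel {f : ℝ → ℝ} (hf : Measurable f) {s : Set ℝ}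
    (hint : IntegrableOn (fun x : ℝ => |f x| * (1 + x ^ 2) ^ (-(3/2) : ℝ)) s) {z : ℝ}
    (hz : z < 0) : IntegrableOn (fun x : ℝ => f x * (x ^ 2 - z) ^ (-(3/2) : ℝ)) s := by
  refine (hint.const_mul ((min 1 (-z)) ^ (-(3/2) : ℝ))).mono'
    (hf.mul (by fun_prop)).aestronglyMeasurable (ae_of_all _ fun x => ?_)
  have hp : 0 < x ^ 2 - z := by nlinarith [sq_nonneg x]
  have hc : 0 < min 1 (-z) := lt_min one_pos (neg_pos.2 hz)
  rw [norm_mul, Real.norm_eq_abs, Real.norm_of_nonneg (Real.rpow_nonneg hp.le _), mul_left_comm]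
  refine mul_le_mul_of_nonneg_left (kernel_le hc ?_) (abs_nonneg _)
  nlinarith [min_le_left 1 (-z), min_le_right 1 (-z), sq_nonneg x]

theorem integrableOn_Ioc_of_weighted {g : ℝ → ℝ} (hg : Measurable g)
    (hint : IntegrableOn (fun x : ℝ => |g x| * (1 + x ^ 2) ^ (-(3/2) : ℝ)) (Ioi 0)) (δ : ℝ) :
    IntegrableOn g (Ioc 0 δ) := by
  refine ((hint.mono_set Ioc_subset_Ioi_self).const_mul ((1 + δ ^ 2) ^ (3/2 : ℝ))).mono'
    hg.aestronglyMeasurable ?_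
  filter_upwards [ae_restrict_mem measurableSet_Ioc] with x hx
  rw [Real.norm_eq_abs, mul_left_comm]
  refine le_mul_of_one_le_right (abs_nonneg _) ?_
  rw [Real.rpow_neg (by positivity), ← div_eq_mul_inv, one_le_div (by positivity)]
  have : x ^ 2 ≤ δ ^ 2 := pow_le_pow_left₀ hx.1.le hx.2 2
  gcongr

theorem antitoneOn_kernel {z : ℝ} (hz : z < 0) :
    AntitoneOn (fun x : ℝ => (x ^ 2 - z) ^ (-(3/2) : ℝ)) (Ioi 0) := by
  intro x hx y _ hxy
  have : x ^ 2 ≤ y ^ 2 := pow_le_pow_left₀ (le_of_lt hx) hxy 2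
  exact Real.rpow_le_rpow_of_nonpos (by nlinarith [sq_nonneg x]) (by linarith) (by norm_num)

theorem tendsto_kernel_of_average_tendsto_zero {g : ℝ → ℝ} (hg : Measurable g)
    (hg0 : ∀ x, 0 ≤ g x)
    (hint : IntegrableOn (fun x : ℝ => g x * (1 + x ^ 2) ^ (-(3/2) : ℝ)) (Ioi 0))
    (hlim : Tendsto (fun h : ℝ => (1 / h) * ∫ y in (0:ℝ)..h, g y) (𝓝[>] 0) (𝓝 0)) :
    Tendsto (fun z : ℝ => -z * ∫ x in Ioi (0:ℝ), g x * (x ^ 2 - z) ^ (-(3/2) : ℝ))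
      (𝓝[<] 0) (𝓝 0) := by
  have hint' : IntegrableOn (fun x : ℝ => |g x| * (1 + x ^ 2) ^ (-(3/2) : ℝ)) (Ioi 0) := by
    simpa only [abs_of_nonneg (hg0 _)] using hint
  have hk0 : ∀ z : ℝ, z < 0 → ∀ x : ℝ, 0 ≤ (x ^ 2 - z) ^ (-(3/2) : ℝ) := fun z hz x =>
    Real.rpow_nonneg (by nlinarith [sq_nonneg x]) _
  have hnn : ∀ z : ℝ, z < 0 →
      0 ≤ -z * ∫ x in Ioi (0:ℝ), g x * (x ^ 2 - z) ^ (-(3/2) : ℝ) := fun z hz =>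
    mul_nonneg (neg_nonneg.2 hz.le)
      (integral_nonneg fun x => mul_nonneg (hg0 x) (hk0 z hz x))
  rw [tendsto_order]
  refine ⟨fun a ha => ?_, fun η hη => ?_⟩
  · filter_upwards [self_mem_nhdsWithin] with z hz using ha.trans_le (hnn z hz)
  obtain ⟨δ, hδ : 0 < δ, hG⟩ : ∃ δ ∈ Ioi (0:ℝ), Ioc 0 δ ⊆
      {h | (1 / h) * ∫ y in (0:ℝ)..h, g y < η / 2} :=
    mem_nhdsGT_iff_exists_Ioc_subset.1 (hlim.eventually (gt_mem_nhds (half_pos hη)))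
  set c := δ ^ 2 / (1 + δ ^ 2) with hc_def
  have hc : 0 < c := by positivity
  set M := ∫ x in Ioi δ, g x * (1 + x ^ 2) ^ (-(3/2) : ℝ)
  have hsub : Ioi δ ⊆ Ioi 0 := Ioi_subset_Ioi hδ.le
  have htail : Tendsto (fun z : ℝ => -z * (c ^ (-(3/2) : ℝ) * M)) (𝓝[<] 0) (𝓝 0) := by
    have : Tendsto (fun z : ℝ => -z * (c ^ (-(3/2) : ℝ) * M)) (𝓝 0)
        (𝓝 (-0 * (c ^ (-(3/2) : ℝ) * M))) := tendsto_id.neg.mul_const _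
    simpa using this.mono_left nhdsWithin_le_nhds
  filter_upwards [self_mem_nhdsWithin, htail.eventually (gt_mem_nhds (half_pos hη))] with z hz hzt
  have hz : z < 0 := hz
  have hgk := integrable_mul_kernel hg hint' hz
  have hk := integrableOn_kernel hz
  have hnear : ∫ x in Ioc 0 δ, g x * (x ^ 2 - z) ^ (-(3/2) : ℝ)
      ≤ η / 2 * ∫ x in Ioi (0:ℝ), (x ^ 2 - z) ^ (-(3/2) : ℝ) := by
    refine (setIntegral_mul_le_of_antitoneOn hg hg0 (by fun_prop) (hk0 z hz)
      (antitoneOn_kernel hz) (half_pos hη).le (integrableOn_Ioc_of_weighted hg hint' δ)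
      (fun r hr => ?_) (hk.mono_set Ioc_subset_Ioi_self)
      (hgk.mono_set Ioc_subset_Ioi_self)).trans ?_
    · have := hG hr
      rw [mem_ofPred_eq, one_div, inv_mul_lt_iff₀ hr.1] at this
      linarith
    · exact mul_le_mul_of_nonneg_left (setIntegral_mono_set hk (ae_of_all _ (hk0 z hz))
        Ioc_subset_Ioi_self.eventuallyLE) (half_pos hη).le
  have hfar : ∫ x in Ioi δ, g x * (x ^ 2 - z) ^ (-(3/2) : ℝ) ≤ c ^ (-(3/2) : ℝ) * M := by
    rw [← integral_const_mul]
    refine setIntegral_mono_on (hgk.mono_set hsub) ((hint.mono_set hsub).const_mul _)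
      measurableSet_Ioi fun x (hx : δ < x) => ?_
    rw [mul_left_comm]
    refine mul_le_mul_of_nonneg_left (kernel_le hc ?_) (hg0 x)
    have : δ ^ 2 ≤ x ^ 2 := pow_le_pow_left₀ hδ.le hx.le 2
    have : c * (1 + x ^ 2) ≤ x ^ 2 := by
      rw [hc_def, div_mul_eq_mul_div, div_le_iff₀ (by positivity)]; nlinarith
    linarith
  rw [← Ioc_union_Ioi_eq_Ioi hδ.le, setIntegral_union (Ioc_disjoint_Ioi le_rfl) measurableSet_Ioi
    (hgk.mono_set Ioc_subset_Ioi_self) (hgk.mono_set hsub), mul_add]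
  have h1 := mul_le_mul_of_nonneg_left hnear (neg_nonneg.2 hz.le)
  rw [mul_left_comm, neg_mul_setIntegral_kernel hz] at h1
  have h2 := mul_le_mul_of_nonneg_left hfar (neg_nonneg.2 hz.le)
  linarith

theorem tendsto_kernel_of_right_lebesgue_point {f : ℝ → ℝ} (hf : Measurable f)
    (hint : IntegrableOn (fun x : ℝ => |f x| * (1 + x ^ 2) ^ (-(3/2) : ℝ)) (Ioi 0)) {α : ℝ}
    (hlim : Tendsto (fun h : ℝ => (1 / h) * ∫ y in (0:ℝ)..h, |f y - α|) (𝓝[>] 0) (𝓝 0)) :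
    Tendsto (fun z : ℝ => -z * ∫ x in Ioi (0:ℝ), f x * (x ^ 2 - z) ^ (-(3/2) : ℝ))
      (𝓝[<] 0) (𝓝 α) := by
  have hk1 : IntegrableOn (fun x : ℝ => (1 + x ^ 2) ^ (-(3/2) : ℝ)) (Ioi 0) := by
    simpa [add_comm] using integrableOn_kernel (z := -1) (by norm_num)
  have hw : Measurable fun x : ℝ => (1 + x ^ 2) ^ (-(3/2) : ℝ) := by fun_prop
  have hmeas : Measurable fun x => |f x - α| := by fun_prop
  have hint' : IntegrableOn (fun x : ℝ => |f x - α| * (1 + x ^ 2) ^ (-(3/2) : ℝ)) (Ioi 0) := by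
    refine (hint.add (hk1.const_mul |α|)).mono' (hmeas.mul hw).aestronglyMeasurable
      (ae_of_all _ fun x => ?_)
    have hp : 0 ≤ (1 + x ^ 2) ^ (-(3/2) : ℝ) := Real.rpow_nonneg (by positivity) _
    rw [Real.norm_of_nonneg (mul_nonneg (abs_nonneg _) hp), Pi.add_apply, ← add_mul]
    exact mul_le_mul_of_nonneg_right (abs_sub _ _) hp
  have h0 := tendsto_kernel_of_average_tendsto_zero hmeas (fun _ => abs_nonneg _) hint' hlim
  rw [tendsto_iff_norm_sub_tendsto_zero]
  refine squeeze_zero' (Eventually.of_forall fun _ => norm_nonneg _) ?_ h0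
  filter_upwards [self_mem_nhdsWithin] with z hz
  have hz : z < 0 := hz
  have e : -z * (∫ x in Ioi (0:ℝ), f x * (x ^ 2 - z) ^ (-(3/2) : ℝ)) - α
      = -z * ∫ x in Ioi (0:ℝ), (f x - α) * (x ^ 2 - z) ^ (-(3/2) : ℝ) := by
    simp_rw [sub_mul]
    rw [integral_sub (integrable_mul_kernel hf hint hz) ((integrableOn_kernel hz).const_mul α),
      integral_const_mul, mul_sub, mul_left_comm _ α, neg_mul_setIntegral_kernel hz, mul_one]
  rw [e, norm_mul, Real.norm_of_nonneg (neg_nonneg.2 hz.le)]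
  refine mul_le_mul_of_nonneg_left ((norm_integral_le_integral_norm _).trans_eq ?_)
    (neg_nonneg.2 hz.le)
  congr with x
  rw [norm_mul, Real.norm_eq_abs, Real.norm_of_nonneg
    (Real.rpow_nonneg (by nlinarith [sq_nonneg x]) _)]

/-- Lemma 4.2 of the paper. For `f` measurable with
`∫ |f(ν)| (1+ν²)^{-3/2} dν < ∞`, the integral `(Tf)(z) = (−z) ∫ f(ν) (ν²−z)^{-3/2} dν`
is absolutely convergent for every `z < 0`; and if `0` is a right Lebesgue point of `f`
with value `αplus` and a left Lebesgue point with value `αminus`, then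
`(Tf)(z) → αplus + αminus` as `z → 0⁻`. -/
theorem statement1 (f : ℝ → ℝ) (hf : Measurable f)
    (hint : Integrable (fun ν : ℝ => |f ν| * (1 + ν ^ 2) ^ (-(3/2) : ℝ))) :
    (∀ z : ℝ, z < 0 → Integrable (fun ν : ℝ => f ν * (ν ^ 2 - z) ^ (-(3/2) : ℝ))) ∧
    ∀ αplus αminus : ℝ,
      Tendsto (fun h : ℝ => (1 / h) * ∫ y in (0:ℝ)..h, |f y - αplus|) (𝓝[>] 0) (𝓝 0) →
      Tendsto (fun h : ℝ => (1 / h) * ∫ y in (-h)..(0:ℝ), |f y - αminus|) (𝓝[>] 0) (𝓝 0) →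
      Tendsto (fun z : ℝ => (-z) * ∫ ν : ℝ, f ν * (ν ^ 2 - z) ^ (-(3/2) : ℝ))
        (𝓝[<] 0) (𝓝 (αplus + αminus)) := by
  have hI : ∀ z : ℝ, z < 0 → Integrable (fun ν : ℝ => f ν * (ν ^ 2 - z) ^ (-(3/2) : ℝ)) :=
    fun z hz => integrableOn_univ.1 (integrable_mul_kernel hf hint.integrableOn hz)
  refine ⟨hI, fun αplus αminus hp hm => ?_⟩
  have h1 := tendsto_kernel_of_right_lebesgue_point hf hint.integrableOn hp
  have hm' : Tendsto (fun h : ℝ => (1 / h) * ∫ y in (0:ℝ)..h, |f (-y) - αminus|)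
      (𝓝[>] 0) (𝓝 0) := by
    refine hm.congr fun h => ?_
    rw [intervalIntegral.integral_comp_neg fun y => |f y - αminus|, neg_zero]
  have hneg : Integrable (fun ν : ℝ => |f (-ν)| * (1 + ν ^ 2) ^ (-(3/2) : ℝ)) := by
    simpa using hint.comp_neg
  have h2 := tendsto_kernel_of_right_lebesgue_point (hf.comp measurable_neg) hneg.integrableOn hm'
  refine (h1.add h2).congr' ?_
  filter_upwards [self_mem_nhdsWithin] with z hz
  have e : ∫ x in Ioi (0:ℝ), f (-x) * (x ^ 2 - z) ^ (-(3/2) : ℝ)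
      = ∫ x in Iic (0:ℝ), f x * (x ^ 2 - z) ^ (-(3/2) : ℝ) := by
    have h := integral_comp_neg_Ioi 0 fun x : ℝ => f x * (x ^ 2 - z) ^ (-(3/2) : ℝ)
    simpa only [neg_sq, neg_zero] using h
  simp only [Function.comp_apply]
  rw [e, ← mul_add, add_comm, intervalIntegral.integral_Iic_add_Ioi (hI z hz).integrableOn
    (hI z hz).integrableOn]
end

section
/- Let f : (0,∞) → ℝ be measurable with ∫₀^∞ |f(λ)| (1 + λ)^{−2} dλ < ∞. Then for every real z < 0 the integral (−z) ∫₀^∞ f(λ) (λ − z)^{−2} dλ is absolutely convergent, and if 0 is a right Lebesgue point of f with value α (i.e. lim_{h↓0} (1/h)∫₀^{h} |f(λ) − α| dλ = 0), then lim_{z→0, z<0} (−z) ∫₀^∞ f(λ) (λ − z)^{−2} dλ = α. -/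
open MeasureTheory Filter Topology Set

/-- If the averages of `g` over the intervals `(0, h]` are at most `c`, then integrating a
nonnegative antitone weight against `g` costs at most `c` times the integral of the weight. -/
lemma setLIntegral_mul_le_of_antitoneOn {φ : ℝ → ℝ} {g : ℝ → ENNReal} {c : ENNReal} {δ : ℝ}
    (hφm : Measurable φ) (hg : Measurable g)
    (hφ : AntitoneOn φ (Ioc 0 δ)) (hφ0 : ∀ x ∈ Ioc 0 δ, 0 ≤ φ x)
    (h : ∀ r ∈ Ioc 0 δ, ∫⁻ y in Ioc 0 r, g y ≤ c * ENNReal.ofReal r) :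
    ∫⁻ x in Ioc 0 δ, g x * ENNReal.ofReal (φ x) ≤
      c * ∫⁻ x in Ioc 0 δ, ENNReal.ofReal (φ x) := by
  have hφ0' : 0 ≤ᵐ[volume.restrict (Ioc 0 δ)] φ :=
    (ae_restrict_iff' measurableSet_Ioc).2 (Eventually.of_forall hφ0)
  have hac : (volume.restrict (Ioc 0 δ)).withDensity g ≪ volume.restrict (Ioc 0 δ) :=
    withDensity_absolutelyContinuous _ _
  have hL : ∫⁻ x in Ioc 0 δ, g x * ENNReal.ofReal (φ x) =
      ∫⁻ x, ENNReal.ofReal (φ x) ∂((volume.restrict (Ioc 0 δ)).withDensity g) :=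
    (lintegral_withDensity_eq_lintegral_mul _ hg hφm.ennreal_ofReal).symm
  rw [hL, lintegral_eq_lintegral_meas_lt _ (hac.ae_le hφ0') hφm.aemeasurable,
    lintegral_eq_lintegral_meas_lt _ hφ0' hφm.aemeasurable]
  have hanti : Antitone fun s : ℝ => volume.restrict (Ioc 0 δ) {a | s < φ a} :=
    fun s s' hs => measure_mono fun a (ha : s' < φ a) => hs.trans_lt ha
  rw [← lintegral_const_mul _ hanti.measurable]
  refine lintegral_mono fun s => ?_
  have hS : MeasurableSet {a | s < φ a} := measurableSet_lt measurable_const hφm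
  rw [withDensity_apply _ hS, Measure.restrict_restrict hS, Measure.restrict_apply hS]
  rcases ({a | s < φ a} ∩ Ioc 0 δ).eq_empty_or_nonempty with he | ⟨x, hx⟩
  · simp [he]
  set S := {a | s < φ a} ∩ Ioc 0 δ
  have hbdd : BddAbove S := ⟨δ, fun y hy => hy.2.2⟩
  have hr : sSup S ∈ Ioc 0 δ :=
    ⟨hx.2.1.trans_le (le_csSup hbdd hx), csSup_le ⟨x, hx⟩ fun y hy => hy.2.2⟩
  have hsub : S ⊆ Ioc 0 (sSup S) := fun y hy => ⟨hy.2.1, le_csSup hbdd hy⟩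
  have hsup : Ioo 0 (sSup S) ⊆ S := by
    intro y hy
    obtain ⟨w, hw, hyw⟩ := exists_lt_of_lt_csSup ⟨x, hx⟩ hy.2
    have hyδ : y ∈ Ioc 0 δ := ⟨hy.1, hyw.le.trans hw.2.2⟩
    exact ⟨lt_of_lt_of_le hw.1 (hφ hyδ hw.2 hyw.le), hyδ⟩
  calc ∫⁻ y in S, g y ≤ ∫⁻ y in Ioc 0 (sSup S), g y := lintegral_mono_set hsub
    _ ≤ c * ENNReal.ofReal (sSup S) := h _ hr
    _ = c * volume (Ioo 0 (sSup S)) := by simp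
    _ ≤ c * volume S := by gcongr

lemma integrableOn_div_add_sq {F : ℝ → ℝ} (hF : Measurable F) {t : ℝ} (ht : 0 < t)
    (hint : IntegrableOn (fun x => |F x| / (1 + x) ^ 2) (Ioi 0)) :
    IntegrableOn (fun x => F x / (x + t) ^ 2) (Ioi 0) := by
  have hm : 0 < min 1 t := lt_min one_pos ht
  refine (hint.const_mul ((min 1 t) ^ 2)⁻¹).mono'
    (Measurable.aestronglyMeasurable (by fun_prop)) ?_
  refine (ae_restrict_iff' measurableSet_Ioi).2 (Eventually.of_forall fun x hx => ?_)
  have hx : 0 < x := hx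
  have hle : min 1 t * (1 + x) ≤ x + t := by
    nlinarith [min_le_left 1 t, min_le_right 1 t]
  rw [Real.norm_eq_abs, abs_div, abs_of_nonneg (sq_nonneg (x + t)), inv_mul_eq_div, div_div,
    mul_comm, ← mul_pow]
  gcongr

lemma integral_Ioi_inv_add_sq {t : ℝ} (ht : 0 < t) :
    IntegrableOn (fun x : ℝ => 1 / (x + t) ^ 2) (Ioi 0) ∧
      ∫ x in Ioi (0 : ℝ), 1 / (x + t) ^ 2 = 1 / t := by
  have hd : ∀ x ∈ Ici (0 : ℝ), HasDerivAt (fun x : ℝ => -(x + t)⁻¹) (1 / (x + t) ^ 2) x := by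
    intro x hx
    have hx : 0 ≤ x := hx
    have := (((hasDerivAt_id x).add_const t).inv (by simp; positivity)).neg
    refine this.congr_deriv ?_
    simp [neg_div]
  have hlim : Tendsto (fun x : ℝ => -(x + t)⁻¹) atTop (𝓝 0) := by
    simpa using (tendsto_inv_atTop_zero.comp (tendsto_atTop_add_const_right atTop t tendsto_id)).neg
  have hnn : ∀ x ∈ Ioi (0 : ℝ), 0 ≤ 1 / (x + t) ^ 2 := fun x _ => by positivity
  refine ⟨integrableOn_Ioi_deriv_of_nonneg' hd hnn hlim, ?_⟩
  rw [integral_Ioi_of_hasDerivAt_of_nonneg' hd hnn hlim]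
  simp

/-- The contribution of a neighbourhood of `0` on which the averages of `g` are at most `c`. -/
lemma mul_setIntegral_Ioc_div_add_sq_le {g : ℝ → ℝ} (hg : Measurable g) (hg0 : ∀ x, 0 ≤ g x)
    {c δ t : ℝ} (ht : 0 < t) (hc : 0 ≤ c) (hgi : IntegrableOn g (Ioc 0 δ))
    (hgt : IntegrableOn (fun x => g x / (x + t) ^ 2) (Ioi 0))
    (h : ∀ r ∈ Ioc 0 δ, ∫ y in Ioc 0 r, g y ≤ c * r) :
    t * ∫ x in Ioc 0 δ, g x / (x + t) ^ 2 ≤ c := by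
  obtain ⟨hki, hkv⟩ := integral_Ioi_inv_add_sq ht
  have key := setLIntegral_mul_le_of_antitoneOn (φ := fun x => 1 / (x + t) ^ 2)
    (g := fun x => ENNReal.ofReal (g x)) (c := ENNReal.ofReal c) (δ := δ)
    (by fun_prop) (by fun_prop)
    (fun x hx y hy hxy => by
      have := hx.1
      dsimp only
      gcongr)
    (fun x _ => by positivity)
    (fun r hr => by
      rw [← ofReal_integral_eq_lintegral_ofReal (hgi.mono_set (Ioc_subset_Ioc_right hr.2))
        (Eventually.of_forall hg0), ← ENNReal.ofReal_mul hc]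
      exact ENNReal.ofReal_le_ofReal (h r hr))
  have hk : ∫⁻ x in Ioc 0 δ, ENNReal.ofReal (1 / (x + t) ^ 2) ≤ ENNReal.ofReal (1 / t) := by
    rw [← hkv, ofReal_integral_eq_lintegral_ofReal hki
      (Eventually.of_forall fun x => by positivity)]
    exact lintegral_mono_set Ioc_subset_Ioi_self
  have hmain : ENNReal.ofReal (∫ x in Ioc 0 δ, g x / (x + t) ^ 2) ≤ ENNReal.ofReal (c * (1 / t)) := by
    rw [ofReal_integral_eq_lintegral_ofReal (hgt.mono_set Ioc_subset_Ioi_self)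
      (Eventually.of_forall fun x => div_nonneg (hg0 x) (sq_nonneg _)), ENNReal.ofReal_mul hc]
    refine le_trans (le_of_eq ?_) (key.trans (by gcongr))
    refine lintegral_congr fun x => ?_
    rw [← ENNReal.ofReal_mul (hg0 x), mul_one_div]
  have := (ENNReal.ofReal_le_ofReal_iff (by positivity)).1 hmain
  calc t * ∫ x in Ioc 0 δ, g x / (x + t) ^ 2 ≤ t * (c * (1 / t)) := by gcongr
    _ = c := by field_simp

/-- The contribution of `(δ, ∞)` is `O(t)`. -/
lemma setIntegral_Ioi_div_add_sq_le {g : ℝ → ℝ} (hg0 : ∀ x, 0 ≤ g x) {δ t : ℝ} (hδ : 0 < δ)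
    (ht : 0 < t) (hint : IntegrableOn (fun x => g x / (1 + x) ^ 2) (Ioi 0))
    (hgt : IntegrableOn (fun x => g x / (x + t) ^ 2) (Ioi 0)) :
    ∫ x in Ioi δ, g x / (x + t) ^ 2 ≤
      ((δ / (1 + δ)) ^ 2)⁻¹ * ∫ x in Ioi δ, g x / (1 + x) ^ 2 := by
  have hsub : Ioi δ ⊆ Ioi 0 := Ioi_subset_Ioi hδ.le
  rw [← integral_const_mul]
  refine setIntegral_mono_on (hgt.mono_set hsub) ((hint.mono_set hsub).const_mul _)
    measurableSet_Ioi fun x hx => ?_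
  have hx : δ < x := hx
  have hx0 : 0 < x := hδ.trans hx
  have hle : δ / (1 + δ) * (1 + x) ≤ x + t := by
    rw [div_mul_eq_mul_div, div_le_iff₀ (by positivity)]
    nlinarith
  rw [inv_mul_eq_div, div_div, mul_comm, ← mul_pow]
  have := hg0 x
  gcongr

lemma tendsto_mul_integral_div_add_sq {f : ℝ → ℝ} (hf : Measurable f)
    (hint : IntegrableOn (fun x => |f x| / (1 + x) ^ 2) (Ioi 0)) {α : ℝ}
    (hα : Tendsto (fun h : ℝ => (1 / h) * ∫ y in (0:ℝ)..h, |f y - α|) (𝓝[>] 0) (𝓝 0)) :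
    Tendsto (fun t : ℝ => t * ∫ x in Ioi (0:ℝ), f x / (x + t) ^ 2) (𝓝[>] 0) (𝓝 α) := by
  have hgm : Measurable fun x => |f x - α| := by fun_prop
  have hgint : IntegrableOn (fun x => |f x - α| / (1 + x) ^ 2) (Ioi 0) := by
    have h1 := integrableOn_div_add_sq hf one_pos hint
    have h2 := (integral_Ioi_inv_add_sq one_pos).1.const_mul α
    refine (h1.sub h2).abs.congr (Eventually.of_forall fun x => ?_)
    simp only [Pi.sub_apply]
    rw [mul_one_div, ← sub_div, abs_div, abs_of_nonneg (sq_nonneg (x + 1)), add_comm x 1]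
  rw [Metric.tendsto_nhds]
  intro ε hε
  obtain ⟨δ, hδ, hδε⟩ : ∃ δ > 0, ∀ r ∈ Ioc 0 δ, ∫ y in Ioc 0 r, |f y - α| ≤ ε / 2 * r := by
    obtain ⟨u, hu, hsub⟩ := mem_nhdsGT_iff_exists_Ioc_subset.1
      (hα.eventually (eventually_lt_nhds (half_pos hε)))
    refine ⟨u, hu, fun r hr => ?_⟩
    have := hsub hr
    simp only [mem_ofPred_eq, intervalIntegral.integral_of_le hr.1.le, one_div_mul_eq_div] at this
    exact ((div_lt_iff₀ hr.1).1 this).le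
  have hgi : IntegrableOn (fun x => |f x - α|) (Ioc 0 δ) := by
    refine ((hgint.mono_set Ioc_subset_Ioi_self).const_mul ((1 + δ) ^ 2)).mono'
      (by fun_prop) ?_
    refine (ae_restrict_iff' measurableSet_Ioc).2 (Eventually.of_forall fun x hx => ?_)
    have := hx.1
    rw [Real.norm_eq_abs, abs_abs, mul_div_assoc', le_div_iff₀ (by positivity), mul_comm]
    gcongr
    exact hx.2
  set K := ((δ / (1 + δ)) ^ 2)⁻¹ * ∫ x in Ioi δ, |f x - α| / (1 + x) ^ 2
  have hK : ∀ᶠ t in 𝓝[>] (0 : ℝ), t * K < ε / 2 := by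
    have : Tendsto (fun t : ℝ => t * K) (𝓝[>] 0) (𝓝 (0 * K)) :=
      (tendsto_id.mul_const K).mono_left nhdsWithin_le_nhds
    rw [zero_mul] at this
    exact this.eventually (eventually_lt_nhds (half_pos hε))
  filter_upwards [hK, self_mem_nhdsWithin] with t htK ht
  have ht : 0 < t := ht
  obtain ⟨hki, hkv⟩ := integral_Ioi_inv_add_sq ht
  have hgt : IntegrableOn (fun x => |f x - α| / (x + t) ^ 2) (Ioi 0) :=
    integrableOn_div_add_sq hgm ht (by simpa only [abs_abs] using hgint)
  have heq : t * (∫ x in Ioi (0:ℝ), f x / (x + t) ^ 2) - α =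
      t * ∫ x in Ioi (0:ℝ), (f x - α) / (x + t) ^ 2 := by
    have : ∀ x, (f x - α) / (x + t) ^ 2 = f x / (x + t) ^ 2 - α * (1 / (x + t) ^ 2) :=
      fun x => by ring
    simp_rw [this]
    rw [integral_sub (integrableOn_div_add_sq hf ht hint) (hki.const_mul α),
      integral_const_mul, hkv]
    field_simp
  have habs : |∫ x in Ioi (0:ℝ), (f x - α) / (x + t) ^ 2| ≤
      ∫ x in Ioi (0:ℝ), |f x - α| / (x + t) ^ 2 := by
    refine abs_integral_le_integral_abs.trans_eq (integral_congr_ae (.of_forall fun x => ?_))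
    simp only [abs_div, abs_of_nonneg (sq_nonneg (x + t))]
  have hsplit : ∫ x in Ioi (0:ℝ), |f x - α| / (x + t) ^ 2 =
      (∫ x in Ioc 0 δ, |f x - α| / (x + t) ^ 2) + ∫ x in Ioi δ, |f x - α| / (x + t) ^ 2 := by
    rw [← Ioc_union_Ioi_eq_Ioi hδ.le]
    exact setIntegral_union (Ioc_disjoint_Ioi le_rfl) measurableSet_Ioi
      (hgt.mono_set Ioc_subset_Ioi_self) (hgt.mono_set (Ioi_subset_Ioi hδ.le))
  have hnear := mul_setIntegral_Ioc_div_add_sq_le hgm (fun x => abs_nonneg _) ht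
    (half_pos hε).le hgi hgt hδε
  have hfar := setIntegral_Ioi_div_add_sq_le (fun x => abs_nonneg (f x - α)) hδ ht hgint hgt
  rw [Real.dist_eq, heq, abs_mul, abs_of_pos ht]
  calc t * |∫ x in Ioi (0:ℝ), (f x - α) / (x + t) ^ 2|
      ≤ t * ((∫ x in Ioc 0 δ, |f x - α| / (x + t) ^ 2) + K) := by
        rw [hsplit] at habs
        gcongr
        exact habs.trans (by gcongr)
    _ < ε := by linarith

/-- Abelian theorem for the resolvent regularization kernel.
For measurable `f : (0,∞) → ℝ` with `∫₀^∞ |f(λ)| (1+λ)^{-2} dλ < ∞`, the integral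
`(−z) ∫₀^∞ f(λ) (λ−z)^{-2} dλ` is absolutely convergent for every `z < 0`, and if `0`
is a right Lebesgue point of `f` with value `α`, then this expression tends to `α`
as `z → 0⁻`. -/
theorem statement2 (f : ℝ → ℝ) (hf : Measurable f)
    (hint : IntegrableOn (fun lam : ℝ => |f lam| / (1 + lam) ^ 2) (Set.Ioi 0)) :
    (∀ z : ℝ, z < 0 → IntegrableOn (fun lam : ℝ => f lam / (lam - z) ^ 2) (Set.Ioi 0)) ∧
    ∀ α : ℝ,
      Tendsto (fun h : ℝ => (1 / h) * ∫ y in (0:ℝ)..h, |f y - α|) (𝓝[>] 0) (𝓝 0) →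
      Tendsto (fun z : ℝ => (-z) * ∫ lam in Set.Ioi (0:ℝ), f lam / (lam - z) ^ 2)
        (𝓝[<] 0) (𝓝 α) := by
  refine ⟨fun z hz => by
    simpa only [← sub_eq_add_neg] using integrableOn_div_add_sq hf (neg_pos.2 hz) hint,
    fun α hα => ?_⟩
  have hneg : Tendsto (fun z : ℝ => -z) (𝓝[<] 0) (𝓝[>] 0) := by
    simpa using tendsto_neg_nhdsLT (a := (0 : ℝ))
  simpa only [Function.comp_def, ← sub_eq_add_neg] using
    (tendsto_mul_integral_div_add_sq hf hint hα).comp hneg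
end

section
/- Let f : (0,∞) → ℝ be measurable with ∫₀^∞ e^{−λ} |f(λ)| dλ < ∞. If 0 is a right Lebesgue point of f with value α (i.e. lim_{h↓0} (1/h)∫₀^{h} |f(λ) − α| dλ = 0), then lim_{t→∞} t ∫₀^∞ e^{−tλ} f(λ) dλ = α. -/
open MeasureTheory Filter Topology Set

/-- The Laplace transform of a nonnegative function, written in terms of its primitive. -/
theorem lintegral_exp_neg_mul_eq_lintegral_primitive {t : ℝ} (ht : 0 < t) {g : ℝ → ENNReal}
    (hg : Measurable g) :
    ∫⁻ x in Ioi (0 : ℝ), ENNReal.ofReal (Real.exp (-(t * x))) * g x =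
      ∫⁻ s in Ioi (0 : ℝ), ENNReal.ofReal (t * Real.exp (-(t * s))) * ∫⁻ x in Ioo 0 s, g x := by
  have hker (x : ℝ) : ENNReal.ofReal (Real.exp (-(t * x))) =
      ∫⁻ s in Ioi x, ENNReal.ofReal (t * Real.exp (-(t * s))) := by
    have hi : IntegrableOn (fun s => t * Real.exp (-(t * s))) (Ioi x) := by
      simpa only [neg_mul, IntegrableOn] using (exp_neg_integrableOn_Ioi x ht).const_mul t
    rw [← ofReal_integral_eq_lintegral_ofReal hi
      (ae_of_all _ fun s => mul_nonneg ht.le (Real.exp_pos _).le), integral_const_mul]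
    have := integral_exp_mul_Ioi (neg_lt_zero.2 ht) x
    simp only [neg_mul] at this
    rw [this]
    congr 1
    field_simp
  let F : ℝ → ℝ → ENNReal := fun x s =>
    {p : ℝ × ℝ | p.1 < p.2}.indicator
      (fun p => ENNReal.ofReal (t * Real.exp (-(t * p.2))) * g p.1) (x, s)
  have hF : Measurable (Function.uncurry F) := by
    refine Measurable.indicator ?_ (measurableSet_lt measurable_fst measurable_snd)
    fun_prop
  calc
    _ = ∫⁻ x in Ioi (0 : ℝ), ∫⁻ s in Ioi (0 : ℝ), F x s := by
      refine setLIntegral_congr_fun measurableSet_Ioi fun x hx => ?_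
      have hFx : F x = (Ioi x).indicator
          (fun s => ENNReal.ofReal (t * Real.exp (-(t * s))) * g x) := by
        ext s; simp [F, indicator]
      have hsub : Ioi x ∩ Ioi 0 = Ioi x := by
        rw [inter_eq_left]; exact Ioi_subset_Ioi (le_of_lt hx)
      rw [hFx, lintegral_indicator measurableSet_Ioi, Measure.restrict_restrict measurableSet_Ioi,
        hsub, lintegral_mul_const _ (by fun_prop), hker]
    _ = ∫⁻ s in Ioi (0 : ℝ), ∫⁻ x in Ioi (0 : ℝ), F x s :=
      lintegral_lintegral_swap hF.aemeasurable
    _ = _ := by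
      refine setLIntegral_congr_fun measurableSet_Ioi fun s hs => ?_
      have hFs : (fun x => F x s) = (Iio s).indicator
          (fun x => ENNReal.ofReal (t * Real.exp (-(t * s))) * g x) := by
        ext x; simp [F, indicator]
      rw [hFs, lintegral_indicator measurableSet_Iio, Measure.restrict_restrict measurableSet_Iio,
        inter_comm, Ioi_inter_Iio, lintegral_const_mul _ hg]

theorem integral_pow_mul_exp_neg_mul_Ioi (n : ℕ) {r : ℝ} (hr : 0 < r) :
    ∫ s in Ioi (0 : ℝ), s ^ n * Real.exp (-(r * s)) = n.factorial / r ^ (n + 1) := by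
  have h := Real.integral_rpow_mul_exp_neg_mul_Ioi (a := n + 1) (by positivity) hr
  rw [Real.Gamma_nat_eq_factorial] at h
  simp only [add_sub_cancel_right, Real.rpow_natCast] at h
  rw [h]
  norm_cast
  rw [one_div, inv_pow, div_eq_inv_mul]

theorem integrableOn_pow_mul_exp_neg_mul_Ioi (n : ℕ) {r : ℝ} (hr : 0 < r) :
    IntegrableOn (fun s : ℝ => s ^ n * Real.exp (-(r * s))) (Ioi 0) :=
  .of_integral_ne_zero (by rw [integral_pow_mul_exp_neg_mul_Ioi n hr]; positivity)

theorem integral_abs_le_exp_mul {g : ℝ → ℝ}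
    (hint : IntegrableOn (fun x => Real.exp (-x) * |g x|) (Ioi 0)) (s : ℝ) :
    ∫ x in Ioo 0 s, |g x| ≤ Real.exp s * ∫ x in Ioi (0 : ℝ), Real.exp (-x) * |g x| := by
  rw [← integral_const_mul]
  calc
    _ ≤ ∫ x in Ioo 0 s, Real.exp s * (Real.exp (-x) * |g x|) := by
      refine integral_mono_of_nonneg (ae_of_all _ fun x => abs_nonneg _)
        ((hint.mono_set Ioo_subset_Ioi_self).const_mul _) ?_
      filter_upwards [ae_restrict_mem measurableSet_Ioo] with x hx
      rw [← mul_assoc, ← Real.exp_add]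
      exact le_mul_of_one_le_left (abs_nonneg _) (Real.one_le_exp (by linarith [hx.2]))
    _ ≤ _ := setIntegral_mono_set (hint.const_mul _)
      (ae_of_all _ fun x => by simp only [Pi.zero_apply]; positivity)
      Ioo_subset_Ioi_self.eventuallyLE

theorem integrableOn_Ioo_of_integrableOn_exp_neg_mul {g : ℝ → ℝ} (hg : Measurable g)
    (hint : IntegrableOn (fun x => Real.exp (-x) * |g x|) (Ioi 0)) (s : ℝ) :
    IntegrableOn (fun x => |g x|) (Ioo 0 s) := by
  refine ((hint.mono_set Ioo_subset_Ioi_self).const_mul (Real.exp s)).mono'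
    hg.abs.aestronglyMeasurable ?_
  filter_upwards [ae_restrict_mem measurableSet_Ioo] with x hx
  rw [← mul_assoc, ← Real.exp_add, Real.norm_eq_abs, abs_abs]
  exact le_mul_of_one_le_left (abs_nonneg _) (Real.one_le_exp (by linarith [hx.2]))

theorem integrableOn_exp_neg_mul_mul {g : ℝ → ℝ} (hg : Measurable g)
    (hint : IntegrableOn (fun x => Real.exp (-x) * |g x|) (Ioi 0)) {t : ℝ} (ht : 1 ≤ t) :
    IntegrableOn (fun x => Real.exp (-(t * x)) * g x) (Ioi 0) := by
  refine hint.mono' (by fun_prop) ?_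
  filter_upwards [ae_restrict_mem measurableSet_Ioi] with x hx
  rw [norm_mul, Real.norm_eq_abs, Real.norm_eq_abs, Real.abs_exp]
  gcongr
  exact le_mul_of_one_le_left (le_of_lt hx) ht

/-- A bound on the primitive of `|g|` gives a bound on the Laplace transform of `|g|`. -/
theorem mul_integral_exp_neg_mul_abs_le {g : ℝ → ℝ} (hg : Measurable g)
    (hint : IntegrableOn (fun x => Real.exp (-x) * |g x|) (Ioi 0)) {ε K : ℝ} (hε : 0 ≤ ε)
    (hK : 0 ≤ K)
    (hb : ∀ s, 0 < s → ∫ x in Ioo 0 s, |g x| ≤ ε * s + K * (s ^ 2 * Real.exp s))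
    {t : ℝ} (ht : 1 < t) :
    t * ∫ x in Ioi (0 : ℝ), Real.exp (-(t * x)) * |g x| ≤
      ε + 2 * K * (t ^ 2 / (t - 1) ^ 3) := by
  have ht0 : 0 < t := by linarith
  have ht1 : 0 < t - 1 := by linarith
  let B : ℝ → ℝ := fun s => t * ε * (s ^ 1 * Real.exp (-(t * s))) +
    t * K * (s ^ 2 * Real.exp (-((t - 1) * s)))
  have hi1 := (integrableOn_pow_mul_exp_neg_mul_Ioi 1 ht0).const_mul (t * ε)
  have hi2 := (integrableOn_pow_mul_exp_neg_mul_Ioi 2 ht1).const_mul (t * K)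
  have hB : IntegrableOn B (Ioi 0) := hi1.add hi2
  have hB0 : 0 ≤ᵐ[volume.restrict (Ioi 0)] B := by
    filter_upwards [ae_restrict_mem measurableSet_Ioi] with s hs
    have : 0 < s := hs
    simp only [Pi.zero_apply, B]
    positivity
  have hBint : ∫ s in Ioi (0 : ℝ), B s = t * ε / t ^ 2 + t * K * (2 / (t - 1) ^ 3) := by
    simp only [B]
    rw [integral_add hi1 hi2, integral_const_mul, integral_const_mul,
      integral_pow_mul_exp_neg_mul_Ioi 1 ht0, integral_pow_mul_exp_neg_mul_Ioi 2 ht1]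
    norm_num [Nat.factorial]
    ring
  have hle : ∫ x in Ioi (0 : ℝ), Real.exp (-(t * x)) * |g x| ≤ ∫ s in Ioi (0 : ℝ), B s := by
    have hgi : IntegrableOn (fun x => Real.exp (-(t * x)) * |g x|) (Ioi 0) :=
      integrableOn_exp_neg_mul_mul hg.abs (by simpa only [abs_abs] using hint) ht.le
    rw [← ENNReal.ofReal_le_ofReal_iff (integral_nonneg_of_ae hB0),
      ofReal_integral_eq_lintegral_ofReal hgi (ae_of_all _ fun x => by
        simp only [Pi.zero_apply]; positivity),
      ofReal_integral_eq_lintegral_ofReal hB hB0]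
    simp only [ENNReal.ofReal_mul (Real.exp_pos _).le]
    rw [lintegral_exp_neg_mul_eq_lintegral_primitive ht0 (by fun_prop)]
    refine setLIntegral_mono' measurableSet_Ioi fun s hs => ?_
    rw [← ofReal_integral_eq_lintegral_ofReal
      (integrableOn_Ioo_of_integrableOn_exp_neg_mul hg hint s) (ae_of_all _ fun x => abs_nonneg _),
      ← ENNReal.ofReal_mul (by positivity)]
    refine ENNReal.ofReal_le_ofReal ((mul_le_mul_of_nonneg_left (hb s hs)
      (by positivity)).trans_eq ?_)
    have : Real.exp (-((t - 1) * s)) = Real.exp (-(t * s)) * Real.exp s := by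
      rw [← Real.exp_add]; congr 1; ring
    simp only [B, this]
    ring
  calc
    _ ≤ t * (t * ε / t ^ 2 + t * K * (2 / (t - 1) ^ 3)) := by
      rw [← hBint]; exact mul_le_mul_of_nonneg_left hle ht0.le
    _ = _ := by field_simp

theorem tendsto_sq_div_sub_one_cube_atTop :
    Tendsto (fun t : ℝ => t ^ 2 / (t - 1) ^ 3) atTop (𝓝 0) := by
  have h := tendsto_inv_atTop_zero.comp (tendsto_atTop_add_const_right atTop (-1 : ℝ) tendsto_id)
  refine squeeze_zero' (g := fun t : ℝ => 4 * (t + -1)⁻¹) ?_ ?_ (by simpa using h.const_mul 4)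
  · filter_upwards [eventually_gt_atTop 1] with t ht
    have : 0 < t - 1 := by linarith
    positivity
  · filter_upwards [eventually_ge_atTop 2] with t ht
    have h1 : 0 < t - 1 := by linarith
    rw [← sub_eq_add_neg, ← div_eq_mul_inv, div_le_div_iff₀ (by positivity) h1]
    nlinarith [mul_nonneg h1.le (show 0 ≤ 4 * (t - 1) ^ 2 - t ^ 2 by nlinarith)]

/-- If the averages of `|g|` on `(0, h)` vanish as `h ↓ 0`, then `t ∫ e^{-tx} |g x| dx → 0`. -/
theorem tendsto_mul_integral_exp_neg_mul_abs_zero {g : ℝ → ℝ} (hg : Measurable g)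
    (hint : IntegrableOn (fun x => Real.exp (-x) * |g x|) (Ioi 0))
    (h0 : Tendsto (fun h : ℝ => (1 / h) * ∫ y in (0 : ℝ)..h, |g y|) (𝓝[>] 0) (𝓝 0)) :
    Tendsto (fun t : ℝ => t * ∫ x in Ioi (0 : ℝ), Real.exp (-(t * x)) * |g x|) atTop (𝓝 0) := by
  have hnn (t : ℝ) : 0 ≤ ∫ x in Ioi (0 : ℝ), Real.exp (-(t * x)) * |g x| :=
    integral_nonneg fun x => by positivity
  refine Metric.tendsto_nhds.2 fun ε hε => ?_
  obtain ⟨δ, hδ, hsmall⟩ := mem_nhdsGT_iff_exists_Ioo_subset.1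
    (h0.eventually (gt_mem_nhds (half_pos hε)))
  have hδ0 : (0 : ℝ) < δ := hδ
  set C := ∫ x in Ioi (0 : ℝ), Real.exp (-x) * |g x|
  have hC0 : 0 ≤ C := integral_nonneg fun x => by positivity
  have hb (s : ℝ) (hs : 0 < s) :
      ∫ x in Ioo 0 s, |g x| ≤ ε / 2 * s + C / δ ^ 2 * (s ^ 2 * Real.exp s) := by
    rcases lt_or_ge s δ with hsδ | hsδ
    · have h1 : 1 / s * ∫ y in (0 : ℝ)..s, |g y| < ε / 2 := hsmall ⟨hs, hsδ⟩
      rw [intervalIntegral.integral_of_le hs.le, integral_Ioc_eq_integral_Ioo, one_div_mul_eq_div,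
        div_lt_iff₀ hs] at h1
      exact h1.le.trans (le_add_of_nonneg_right (by positivity))
    · calc
        _ ≤ Real.exp s * C := integral_abs_le_exp_mul hint s
        _ = C / δ ^ 2 * (δ ^ 2 * Real.exp s) := by field_simp
        _ ≤ C / δ ^ 2 * (s ^ 2 * Real.exp s) := by gcongr
        _ ≤ _ := le_add_of_nonneg_left (by positivity)
  have hlim : Tendsto (fun t : ℝ => ε / 2 + 2 * (C / δ ^ 2) * (t ^ 2 / (t - 1) ^ 3)) atTop
      (𝓝 (ε / 2)) := by
    simpa using (tendsto_sq_div_sub_one_cube_atTop.const_mul (2 * (C / δ ^ 2))).const_add (ε / 2)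
  filter_upwards [hlim.eventually (gt_mem_nhds (half_lt_self hε)), eventually_gt_atTop 1]
    with t hlt ht
  rw [Real.dist_0_eq_abs, abs_of_nonneg (mul_nonneg (by linarith) (hnn t))]
  exact (mul_integral_exp_neg_mul_abs_le hg hint (half_pos hε).le (by positivity) hb ht).trans_lt
    hlt

/-- Abelian theorem for the Laplace transform. Let `f : (0,∞) → ℝ` be
measurable with `∫₀^∞ e^{−λ} |f(λ)| dλ < ∞`. If `0` is a right Lebesgue point of `f`
with value `α`, then `t ∫₀^∞ e^{−tλ} f(λ) dλ → α` as `t → ∞`. -/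
theorem statement3 (f : ℝ → ℝ) (hf : Measurable f)
    (hint : IntegrableOn (fun lam : ℝ => Real.exp (-lam) * |f lam|) (Set.Ioi 0)) (α : ℝ)
    (hα : Tendsto (fun h : ℝ => (1 / h) * ∫ y in (0:ℝ)..h, |f y - α|) (𝓝[>] 0) (𝓝 0)) :
    Tendsto (fun t : ℝ => t * ∫ lam in Set.Ioi (0:ℝ), Real.exp (-(t * lam)) * f lam)
      atTop (𝓝 α) := by
  have hexp (t : ℝ) (ht : 0 < t) :
      IntegrableOn (fun x : ℝ => Real.exp (-(t * x))) (Ioi 0) := by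
    simpa using integrableOn_pow_mul_exp_neg_mul_Ioi 0 ht
  have hg : Measurable fun x => f x - α := hf.sub_const α
  have hgint : IntegrableOn (fun x => Real.exp (-x) * |f x - α|) (Ioi 0) := by
    have hα' := (hexp 1 one_pos).mul_const |α|
    simp only [one_mul] at hα'
    refine (hint.add hα').mono' (by fun_prop) (ae_of_all _ fun x => ?_)
    rw [Real.norm_eq_abs, abs_mul, abs_abs, Real.abs_exp, Pi.add_apply, ← mul_add]
    gcongr
    exact norm_sub_le (f x) α
  refine tendsto_iff_norm_sub_tendsto_zero.2 (squeeze_zero' (Eventually.of_forall fun _ =>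
    norm_nonneg _) ?_ (tendsto_mul_integral_exp_neg_mul_abs_zero hg hgint hα))
  filter_upwards [eventually_ge_atTop 1] with t ht
  have ht0 : 0 < t := by linarith
  have hE : t * ∫ x in Ioi (0 : ℝ), Real.exp (-(t * x)) * α = α := by
    have h := integral_pow_mul_exp_neg_mul_Ioi 0 ht0
    simp only [pow_zero, one_mul, zero_add, pow_one, Nat.factorial_zero, Nat.cast_one] at h
    rw [integral_mul_const, h]
    field_simp
  have hsub : (t * ∫ x in Ioi (0 : ℝ), Real.exp (-(t * x)) * f x) - α =
      t * ∫ x in Ioi (0 : ℝ), Real.exp (-(t * x)) * (f x - α) := by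
    simp only [mul_sub]
    rw [integral_sub (integrableOn_exp_neg_mul_mul hf hint ht) ((hexp t ht0).mul_const α),
      mul_sub, hE]
  rw [hsub, norm_mul, Real.norm_of_nonneg ht0.le]
  gcongr
  refine (norm_integral_le_integral_norm _).trans_eq ?_
  simp only [norm_mul, Real.norm_eq_abs, Real.abs_exp]
end

section
/- (Stieltjes inversion formula.) Let ξ ∈ L¹(ℝ) be real-valued and define F(z) = ∫_ℝ ξ(λ)/(λ − z) dλ for Im z > 0. Then for every Lebesgue point x of ξ with value α (i.e. lim_{h↓0} (1/(2h))∫_{x−h}^{x+h} |ξ(y) − α| dy = 0), one has lim_{ε↓0} (1/π) Im F(x + iε) = α. In particular, (1/π) lim_{ε↓0} Im F(λ + iε) = ξ(λ) for almost every λ ∈ ℝ, so ξ is uniquely determined by F. -/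
open MeasureTheory Filter Topology Set

/-- The Poisson kernel of the upper half plane, normalized to have integral one. -/
noncomputable def poissonKernelLine (x ε y : ℝ) : ℝ :=
  Real.pi⁻¹ * ε * ((y - x) ^ 2 + ε ^ 2)⁻¹

lemma poissonKernelLine_eq_cauchyPDFReal (x : ℝ) {ε : ℝ} (hε : 0 < ε) :
    poissonKernelLine x ε = ProbabilityTheory.cauchyPDFReal x ε.toNNReal := by
  ext y
  simp [poissonKernelLine, ProbabilityTheory.cauchyPDFReal_def, hε.le]

lemma poissonKernelLine_nonneg (x : ℝ) {ε : ℝ} (hε : 0 < ε) (y : ℝ) :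
    0 ≤ poissonKernelLine x ε y := by
  unfold poissonKernelLine
  positivity

lemma measurable_poissonKernelLine (x ε : ℝ) : Measurable (poissonKernelLine x ε) := by
  unfold poissonKernelLine
  fun_prop

lemma integrable_poissonKernelLine (x : ℝ) {ε : ℝ} (hε : 0 < ε) :
    Integrable (poissonKernelLine x ε) := by
  rw [poissonKernelLine_eq_cauchyPDFReal x hε]
  exact ProbabilityTheory.integrable_cauchyPDFReal x

lemma integral_poissonKernelLine (x : ℝ) {ε : ℝ} (hε : 0 < ε) :
    ∫ y, poissonKernelLine x ε y = 1 := by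
  rw [poissonKernelLine_eq_cauchyPDFReal x hε]
  exact ProbabilityTheory.integral_cauchyPDFReal_eq_one x (by simpa using hε)

lemma poissonKernelLine_le (x : ℝ) {ε : ℝ} (hε : 0 < ε) (y : ℝ) :
    poissonKernelLine x ε y ≤ ε * ((y - x) ^ 2 + ε ^ 2)⁻¹ := by
  unfold poissonKernelLine
  have hpi : Real.pi⁻¹ ≤ 1 := inv_le_one_of_one_le₀ (by linarith [Real.pi_gt_three])
  rw [mul_assoc]
  exact mul_le_of_le_one_left (by positivity) hpi

lemma poissonKernelLine_le_inv (x : ℝ) {ε : ℝ} (hε : 0 < ε) (y : ℝ) :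
    poissonKernelLine x ε y ≤ ε⁻¹ := by
  refine (poissonKernelLine_le x hε y).trans ?_
  rw [← div_eq_mul_inv, div_le_iff₀ (by positivity)]
  field_simp
  nlinarith [sq_nonneg (y - x)]

/-- The Poisson kernel is dominated by a dyadic step function centred at its peak. -/
lemma exists_poissonKernelLine_le_dyadic (x : ℝ) {ε : ℝ} (hε : 0 < ε) (y : ℝ) :
    ∃ n : ℕ, |y - x| ≤ 2 ^ n * ε ∧
      poissonKernelLine x ε y ≤ 8 * (1 / 2) ^ n * (1 / (2 * (2 ^ n * ε))) := by
  rcases le_or_gt (|y - x|) ε with h | h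
  · refine ⟨0, by simpa using h, (poissonKernelLine_le_inv x hε y).trans ?_⟩
    field_simp
    norm_num
  · obtain ⟨n, hn, hn'⟩ := exists_nat_pow_near ((one_le_div hε).2 h.le) (one_lt_two)
    rw [le_div_iff₀ hε] at hn
    rw [div_lt_iff₀ hε] at hn'
    refine ⟨n + 1, hn'.le, (poissonKernelLine_le x hε y).trans ?_⟩
    have hsq : (2 ^ n * ε) ^ 2 ≤ (y - x) ^ 2 := by
      rw [← sq_abs (y - x)]
      gcongr
    calc ε * ((y - x) ^ 2 + ε ^ 2)⁻¹ ≤ ε * ((2 ^ n * ε) ^ 2)⁻¹ := by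
          gcongr
          nlinarith [sq_nonneg ε]
      _ = 8 * (1 / 2) ^ (n + 1) * (1 / (2 * (2 ^ (n + 1) * ε))) := by
          rw [one_div_pow]
          field_simp
          ring

/-- The mean of `g` over the interval of radius `h` around `x`. -/
noncomputable def symmetricMean (g : ℝ → ℝ) (x h : ℝ) : ℝ :=
  (1 / (2 * h)) * ∫ y in (x - h)..(x + h), g y

lemma symmetricMean_eq_setIntegral (g : ℝ → ℝ) (x : ℝ) {h : ℝ} (hh : 0 < h) :
    symmetricMean g x h = (1 / (2 * h)) * ∫ y in Metric.closedBall x h, g y := by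
  rw [symmetricMean, intervalIntegral.integral_of_le (by linarith), Real.closedBall_eq_Icc,
    integral_Icc_eq_integral_Ioc]

lemma symmetricMean_nonneg {g : ℝ → ℝ} (hg : ∀ y, 0 ≤ g y) (x : ℝ) {h : ℝ} (hh : 0 < h) :
    0 ≤ symmetricMean g x h := by
  rw [symmetricMean_eq_setIntegral g x hh]
  exact mul_nonneg (by positivity) (integral_nonneg hg)

/-- A Poisson integral is controlled by a geometrically weighted sum of dyadic means. -/
lemma integral_poissonKernelLine_mul_le {g : ℝ → ℝ} (hg : ∀ y, 0 ≤ g y)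
    (hgl : LocallyIntegrable g) (x : ℝ) {ε : ℝ} (hε : 0 < ε)
    (hs : Summable fun n : ℕ => 8 * (1 / 2) ^ n * symmetricMean g x (2 ^ n * ε)) :
    ∫ y, poissonKernelLine x ε y * g y ≤
      ∑' n : ℕ, 8 * (1 / 2) ^ n * symmetricMean g x (2 ^ n * ε) := by
  have hr (n : ℕ) : 0 < 2 ^ n * ε := by positivity
  have hnn (n : ℕ) : 0 ≤ 8 * (1 / 2) ^ n * symmetricMean g x (2 ^ n * ε) :=
    mul_nonneg (by positivity) (symmetricMean_nonneg hg x (hr n))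
  have hgm : AEMeasurable g := hgl.aestronglyMeasurable.aemeasurable
  rw [integral_eq_lintegral_of_nonneg_ae
    (ae_of_all _ fun y => mul_nonneg (poissonKernelLine_nonneg x hε y) (hg y))
    ((measurable_poissonKernelLine x ε).aestronglyMeasurable.mul hgl.aestronglyMeasurable)]
  refine ENNReal.toReal_le_of_le_ofReal (tsum_nonneg hnn) ?_
  set c : ℕ → ℝ := fun n => 8 * (1 / 2) ^ n * (1 / (2 * (2 ^ n * ε))) with hc
  have hc0 (n : ℕ) : 0 ≤ c n := by positivity
  calc ∫⁻ y, ENNReal.ofReal (poissonKernelLine x ε y * g y)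
      ≤ ∫⁻ y, ∑' n : ℕ, (Metric.closedBall x (2 ^ n * ε)).indicator
          (fun y => ENNReal.ofReal (c n * g y)) y := by
        refine lintegral_mono fun y => ?_
        obtain ⟨n, hn, hle⟩ := exists_poissonKernelLine_le_dyadic x hε y
        refine le_trans ?_ (ENNReal.le_tsum n)
        rw [indicator_of_mem (by simpa [Real.dist_eq] using hn)]
        exact ENNReal.ofReal_le_ofReal (mul_le_mul_of_nonneg_right hle (hg y))
    _ = ∑' n : ℕ, ∫⁻ y in Metric.closedBall x (2 ^ n * ε), ENNReal.ofReal (c n * g y) := by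
        rw [lintegral_tsum fun n => ((hgm.const_mul (c n)).ennreal_ofReal).indicator
          measurableSet_closedBall]
        exact tsum_congr fun n => lintegral_indicator measurableSet_closedBall _
    _ = ∑' n : ℕ, ENNReal.ofReal (8 * (1 / 2) ^ n * symmetricMean g x (2 ^ n * ε)) := by
        refine tsum_congr fun n => ?_
        rw [← ofReal_integral_eq_lintegral_ofReal
          ((hgl.integrableOn_isCompact (isCompact_closedBall _ _)).const_mul (c n))
          (ae_of_all _ fun y => mul_nonneg (hc0 n) (hg y)), integral_const_mul,
          symmetricMean_eq_setIntegral g x (hr n), ← mul_assoc]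
    _ = ENNReal.ofReal (∑' n : ℕ, 8 * (1 / 2) ^ n * symmetricMean g x (2 ^ n * ε)) :=
        (ENNReal.ofReal_tsum_of_nonneg hnn hs).symm

/-- If the means of `g ≥ 0` around `x` are bounded and vanish at small scales, then so do the
Poisson integrals of `g` at `x`. -/
lemma tendsto_integral_poissonKernelLine_mul_zero {g : ℝ → ℝ} (hg : ∀ y, 0 ≤ g y)
    (hgl : LocallyIntegrable g) {x M : ℝ} (hM : ∀ h, 0 < h → symmetricMean g x h ≤ M)
    (hlim : Tendsto (symmetricMean g x) (𝓝[>] 0) (𝓝 0)) :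
    Tendsto (fun ε => ∫ y, poissonKernelLine x ε y * g y) (𝓝[>] 0) (𝓝 0) := by
  have hbs : Summable fun n : ℕ => 8 * (1 / 2 : ℝ) ^ n * M :=
    (summable_geometric_two.mul_left 8).mul_right M
  have hbound {ε : ℝ} (hε : 0 < ε) (n : ℕ) :
      ‖8 * (1 / 2) ^ n * symmetricMean g x (2 ^ n * ε)‖ ≤ 8 * (1 / 2 : ℝ) ^ n * M := by
    have hr : 0 < 2 ^ n * ε := by positivity
    rw [Real.norm_of_nonneg (mul_nonneg (by positivity) (symmetricMean_nonneg hg x hr))]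
    exact mul_le_mul_of_nonneg_left (hM _ hr) (by positivity)
  have hpos : ∀ᶠ ε : ℝ in 𝓝[>] 0, 0 < ε := self_mem_nhdsWithin
  have hterm (n : ℕ) : Tendsto (fun ε => 8 * (1 / 2) ^ n * symmetricMean g x (2 ^ n * ε))
      (𝓝[>] 0) (𝓝 0) := by
    have hscale : Tendsto (fun ε : ℝ => 2 ^ n * ε) (𝓝[>] 0) (𝓝[>] 0) := by
      refine tendsto_nhdsWithin_iff.2 ⟨?_, hpos.mono fun ε hε => mem_Ioi.2 (by positivity)⟩
      exact ((continuous_const_mul (2 ^ n : ℝ)).tendsto' 0 0 (by simp)).mono_left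
        nhdsWithin_le_nhds
    simpa only [mul_zero, Function.comp_def] using (hlim.comp hscale).const_mul (8 * (1 / 2) ^ n)
  have hsum := tendsto_tsum_of_dominated_convergence hbs hterm
    (hpos.mono fun ε hε => hbound hε)
  rw [tsum_zero] at hsum
  refine squeeze_zero' (hpos.mono fun ε hε => integral_nonneg fun y =>
    mul_nonneg (poissonKernelLine_nonneg x hε y) (hg y)) (hpos.mono fun ε hε => ?_) hsum
  exact integral_poissonKernelLine_mul_le hg hgl x hε (hbs.of_norm_bounded (hbound hε))

/-- Vanishing of the means at small scales makes them bounded at all scales, for functions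
that differ from an integrable function by a constant. -/
lemma exists_symmetricMean_abs_sub_le {ξ : ℝ → ℝ} (hξ : Integrable ξ) {x α : ℝ}
    (hlim : Tendsto (symmetricMean (fun y => |ξ y - α|) x) (𝓝[>] 0) (𝓝 0)) :
    ∃ M, ∀ h, 0 < h → symmetricMean (fun y => |ξ y - α|) x h ≤ M := by
  obtain ⟨δ, hδ, hsmall⟩ := mem_nhdsGT_iff_exists_Ioo_subset.1
    (hlim.eventually (Iic_mem_nhds zero_lt_one))
  have hδ : 0 < δ := hδ
  have hI : 0 ≤ ∫ y, |ξ y| := integral_nonneg fun y => abs_nonneg _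
  refine ⟨1 + (1 / (2 * δ) * (∫ y, |ξ y|) + |α|), fun h hh => ?_⟩
  rcases lt_or_ge h δ with hlt | hge
  · have h1 : symmetricMean (fun y => |ξ y - α|) x h ≤ 1 := hsmall ⟨hh, hlt⟩
    have : 0 ≤ 1 / (2 * δ) * (∫ y, |ξ y|) + |α| := by positivity
    linarith
  · have hint : ∫ y in Metric.closedBall x h, |ξ y - α| ≤ (∫ y, |ξ y|) + 2 * h * |α| := by
      have hc : IntegrableOn (fun _ : ℝ => |α|) (Metric.closedBall x h) :=
        integrableOn_const measure_closedBall_lt_top.ne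
      calc ∫ y in Metric.closedBall x h, |ξ y - α|
          ≤ ∫ y in Metric.closedBall x h, (|ξ y| + |α|) :=
            integral_mono_of_nonneg (ae_of_all _ fun y => abs_nonneg _)
              (hξ.abs.integrableOn.add hc) (ae_of_all _ fun y => abs_sub _ _)
        _ = (∫ y in Metric.closedBall x h, |ξ y|) + 2 * h * |α| := by
            rw [integral_add hξ.abs.integrableOn hc, setIntegral_const,
              Real.volume_real_closedBall hh.le, smul_eq_mul]
        _ ≤ (∫ y, |ξ y|) + 2 * h * |α| := by
            gcongr
            · exact ae_of_all _ fun y => abs_nonneg _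
            · exact hξ.abs
            · exact Measure.restrict_le_self
    rw [symmetricMean_eq_setIntegral _ x hh]
    calc 1 / (2 * h) * ∫ y in Metric.closedBall x h, |ξ y - α|
        ≤ 1 / (2 * h) * ((∫ y, |ξ y|) + 2 * h * |α|) := by gcongr
      _ = 1 / (2 * h) * (∫ y, |ξ y|) + |α| := by field_simp
      _ ≤ 1 / (2 * δ) * (∫ y, |ξ y|) + |α| := by gcongr
      _ ≤ _ := by linarith

lemma integrable_poissonKernelLine_mul {ξ : ℝ → ℝ} (hξ : Integrable ξ) (x : ℝ) {ε : ℝ}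
    (hε : 0 < ε) : Integrable fun y => poissonKernelLine x ε y * ξ y :=
  hξ.bdd_mul (c := ε⁻¹) (measurable_poissonKernelLine x ε).aestronglyMeasurable
    (ae_of_all _ fun y => by
      rw [Real.norm_of_nonneg (poissonKernelLine_nonneg x hε y)]
      exact poissonKernelLine_le_inv x hε y)

/-- The imaginary part of the Cauchy transform is a Poisson integral. -/
lemma im_cauchyTransform_eq_integral_poissonKernelLine {ξ : ℝ → ℝ} (hξ : Integrable ξ) (x : ℝ)
    {ε : ℝ} (hε : 0 < ε) :
    (1 / Real.pi) *
        (∫ lam : ℝ, (ξ lam : ℂ) / ((lam : ℂ) - ((x : ℂ) + (ε : ℂ) * Complex.I))).im =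
      ∫ y, poissonKernelLine x ε y * ξ y := by
  have him (y : ℝ) : ((y : ℂ) - ((x : ℂ) + (ε : ℂ) * Complex.I)).im = -ε := by simp
  have hint : Integrable fun y : ℝ =>
      (ξ y : ℂ) / ((y : ℂ) - ((x : ℂ) + (ε : ℂ) * Complex.I)) := by
    simp only [div_eq_mul_inv]
    refine hξ.ofReal.mul_bdd (c := ε⁻¹) (Measurable.aestronglyMeasurable (by fun_prop))
      (ae_of_all _ fun y => ?_)
    rw [norm_inv]
    gcongr
    simpa [him, abs_of_pos hε] using
      Complex.abs_im_le_norm ((y : ℂ) - ((x : ℂ) + (ε : ℂ) * Complex.I))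
  have hre := integral_im hint
  simp only [RCLike.im_to_complex] at hre
  rw [← hre, ← integral_const_mul]
  congr with y
  rw [Complex.div_im, him, Complex.normSq_apply, him]
  simp only [poissonKernelLine, Complex.ofReal_im, Complex.ofReal_re, Complex.sub_re,
    Complex.add_re, Complex.mul_re, Complex.I_re, Complex.I_im]
  ring_nf

lemma tendsto_im_cauchyTransform {ξ : ℝ → ℝ} (hξ : Integrable ξ) {x α : ℝ}
    (hlim : Tendsto (symmetricMean (fun y => |ξ y - α|) x) (𝓝[>] 0) (𝓝 0)) :
    Tendsto (fun ε : ℝ =>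
        (1 / Real.pi) *
          (∫ lam : ℝ, (ξ lam : ℂ) / ((lam : ℂ) - ((x : ℂ) + (ε : ℂ) * Complex.I))).im)
      (𝓝[>] 0) (𝓝 α) := by
  obtain ⟨M, hM⟩ := exists_symmetricMean_abs_sub_le hξ hlim
  have hgl : LocallyIntegrable fun y => |ξ y - α| :=
    fun y => (hξ.locallyIntegrable.sub (locallyIntegrable_const α) y).norm
  have hzero := tendsto_integral_poissonKernelLine_mul_zero (fun y => abs_nonneg (ξ y - α))
    hgl hM hlim
  refine tendsto_iff_norm_sub_tendsto_zero.2 (squeeze_zero' (Eventually.of_forall fun _ =>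
    norm_nonneg _) ?_ hzero)
  filter_upwards [self_mem_nhdsWithin] with ε (hε : 0 < ε)
  have hdiff : (∫ y, poissonKernelLine x ε y * ξ y) - α =
      ∫ y, poissonKernelLine x ε y * (ξ y - α) := by
    simp only [mul_sub]
    rw [integral_sub (integrable_poissonKernelLine_mul hξ x hε)
      ((integrable_poissonKernelLine x hε).mul_const α), integral_mul_const,
      integral_poissonKernelLine x hε, one_mul]
  rw [im_cauchyTransform_eq_integral_poissonKernelLine hξ x hε, hdiff]
  refine (norm_integral_le_integral_norm _).trans_eq (integral_congr_ae (ae_of_all _ fun y => ?_))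
  simp only [norm_mul, Real.norm_of_nonneg (poissonKernelLine_nonneg x hε y), Real.norm_eq_abs]

/-- Almost every point is a Lebesgue point. -/
lemma ae_tendsto_symmetricMean_abs_sub {ξ : ℝ → ℝ} (hξ : LocallyIntegrable ξ) :
    ∀ᵐ x : ℝ, Tendsto (symmetricMean (fun y => |ξ y - ξ x|) x) (𝓝[>] 0) (𝓝 0) := by
  filter_upwards [IsUnifLocDoublingMeasure.ae_tendsto_average_norm_sub volume hξ 1] with x hx
  have hpos : ∀ᶠ h : ℝ in 𝓝[>] 0, 0 < h := self_mem_nhdsWithin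
  refine (hx (fun _ => x) id tendsto_id (hpos.mono fun h hh => ?_)).congr'
    (hpos.mono fun h hh => ?_)
  · exact Metric.mem_closedBall_self (by simpa using hh.le)
  · rw [symmetricMean_eq_setIntegral _ x hh, setAverage_eq, id,
      Real.volume_real_closedBall hh.le, smul_eq_mul, one_div]
    simp only [Real.norm_eq_abs]

/-- Stieltjes inversion formula. Let `ξ ∈ L¹(ℝ)` be real-valued and
`F(z) = ∫_ℝ ξ(λ)/(λ − z) dλ` for `Im z > 0`. Then at every Lebesgue point `x` of `ξ`
with value `α` one has `(1/π) Im F(x + iε) → α` as `ε ↓ 0`; in particular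
`(1/π) lim_{ε↓0} Im F(λ + iε) = ξ(λ)` for almost every `λ ∈ ℝ`. -/
theorem statement5 (ξ : ℝ → ℝ) (hξ : Integrable ξ) :
    (∀ x α : ℝ,
      Tendsto (fun h : ℝ => (1 / (2 * h)) * ∫ y in (x - h)..(x + h), |ξ y - α|)
        (𝓝[>] 0) (𝓝 0) →
      Tendsto (fun ε : ℝ =>
          (1 / Real.pi) *
            (∫ lam : ℝ, (ξ lam : ℂ) / ((lam : ℂ) - ((x : ℂ) + (ε : ℂ) * Complex.I))).im)
        (𝓝[>] 0) (𝓝 α)) ∧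
    ∀ᵐ x : ℝ,
      Tendsto (fun ε : ℝ =>
          (1 / Real.pi) *
            (∫ lam : ℝ, (ξ lam : ℂ) / ((lam : ℂ) - ((x : ℂ) + (ε : ℂ) * Complex.I))).im)
        (𝓝[>] 0) (𝓝 (ξ x)) := by
  exact ⟨fun x α hlim => tendsto_im_cauchyTransform hξ hlim,
    (ae_tendsto_symmetricMean_abs_sub hξ.locallyIntegrable).mono
      fun x hlim => tendsto_im_cauchyTransform hξ hlim⟩
end

section
/- (Krein's trace formula in finite dimensions.) Let H₀ and H be n×n Hermitian complex matrices and let f : ℝ → ℝ be continuously differentiable. Then Σ_{i=1}^n f(λᵢ(H)) − Σ_{i=1}^n f(λᵢ(H₀)) = ∫_ℝ f'(t) (N_H(t) − N_{H₀}(t)) dt; that is, tr(f(H) − f(H₀)) = ∫_ℝ f'(t) ξ(t) dt with spectral shift function ξ(t) = N_H(t) − N_{H₀}(t). -/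
open MeasureTheory Matrix

/-- Eigenvalue counting function `N_A(t) = #{i : λᵢ(A) > t}` of a Hermitian matrix `A`. -/
noncomputable def countingFunction {n : ℕ} {A : Matrix (Fin n) (Fin n) ℂ}
    (hA : A.IsHermitian) (t : ℝ) : ℕ :=
  Nat.card {i : Fin n // t < hA.eigenvalues i}

lemma countingFunction_eq_sum {n : ℕ} {A : Matrix (Fin n) (Fin n) ℂ} (hA : A.IsHermitian)
    (t : ℝ) : (countingFunction hA t : ℝ) = ∑ i, if t < hA.eigenvalues i then (1 : ℝ) else 0 := by
  rw [countingFunction, Nat.card_eq_fintype_card, Fintype.card_subtype, Finset.sum_boole]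

lemma mul_ite_lt_sub_ite_lt_eq_indicator (g : ℝ → ℝ) {a b : ℝ} (hab : a ≤ b) :
    (fun t => g t * ((if t < b then (1 : ℝ) else 0) - (if t < a then (1 : ℝ) else 0)))
      = (Set.Ico a b).indicator g := by
  ext t
  by_cases h1 : t < a
  · have h2 : t < b := h1.trans_le hab
    simp [h1, h2]
  · by_cases h2 : t < b <;> simp [h1, h2, Set.indicator, not_lt.mp h1]

/-- Integral of the derivative against the difference of two step functions, for ordered jumps. -/
lemma integrable_and_integral_deriv_mul_step_of_le {f : ℝ → ℝ} (hf : ContDiff ℝ 1 f) {a b : ℝ}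
    (hab : a ≤ b) :
    Integrable (fun t => deriv f t *
        ((if t < b then (1 : ℝ) else 0) - (if t < a then (1 : ℝ) else 0))) ∧
      ∫ t, deriv f t * ((if t < b then (1 : ℝ) else 0) - (if t < a then (1 : ℝ) else 0))
        = f b - f a := by
  have hc : Continuous (deriv f) := hf.continuous_deriv_one
  rw [mul_ite_lt_sub_ite_lt_eq_indicator _ hab]
  refine ⟨(integrable_indicator_iff measurableSet_Ico).2
    (hc.continuousOn.integrableOn_Icc.mono_set Set.Ico_subset_Icc_self), ?_⟩
  rw [integral_indicator measurableSet_Ico, integral_Ico_eq_integral_Ioc,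
    ← intervalIntegral.integral_of_le hab]
  exact intervalIntegral.integral_deriv_eq_sub' f rfl
    (fun x _ => hf.differentiable one_ne_zero x) hc.continuousOn

/-- Integral of the derivative against the difference of two step functions. -/
lemma integrable_and_integral_deriv_mul_step {f : ℝ → ℝ} (hf : ContDiff ℝ 1 f) (a b : ℝ) :
    Integrable (fun t => deriv f t *
        ((if t < b then (1 : ℝ) else 0) - (if t < a then (1 : ℝ) else 0))) ∧
      ∫ t, deriv f t * ((if t < b then (1 : ℝ) else 0) - (if t < a then (1 : ℝ) else 0))
        = f b - f a := by
  rcases le_total a b with hab | hba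
  · exact integrable_and_integral_deriv_mul_step_of_le hf hab
  · obtain ⟨hint, heq⟩ := integrable_and_integral_deriv_mul_step_of_le hf hba
    have hneg : (fun t => deriv f t *
        ((if t < b then (1 : ℝ) else 0) - (if t < a then (1 : ℝ) else 0))) = fun t =>
        -(deriv f t * ((if t < a then (1 : ℝ) else 0) - (if t < b then (1 : ℝ) else 0))) := by
      ext t
      ring
    rw [hneg]
    exact ⟨hint.neg, by rw [integral_neg, heq, neg_sub]⟩

/-- Krein's trace formula in finite dimensions.
`tr(f(H) − f(H₀)) = ∫_ℝ f'(t) (N_H(t) − N_{H₀}(t)) dt` for Hermitian matrices `H₀, H`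
and continuously differentiable `f : ℝ → ℝ`. -/
theorem statement6 {n : ℕ} {H₀ H : Matrix (Fin n) (Fin n) ℂ}
    (hH₀ : H₀.IsHermitian) (hH : H.IsHermitian) (f : ℝ → ℝ) (hf : ContDiff ℝ 1 f) :
    (∑ i, f (hH.eigenvalues i)) - (∑ i, f (hH₀.eigenvalues i))
      = ∫ t : ℝ, deriv f t * ((countingFunction hH t : ℝ) - (countingFunction hH₀ t : ℝ)) := by
  simp_rw [countingFunction_eq_sum, ← Finset.sum_sub_distrib, Finset.mul_sum]
  rw [integral_finsetSum _ fun i _ => (integrable_and_integral_deriv_mul_step hf _ _).1]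
  exact Finset.sum_congr rfl fun i _ => (integrable_and_integral_deriv_mul_step hf _ _).2.symm
end

section
/- Let H₀ and H be n×n Hermitian complex matrices. Then for every t ∈ ℝ, |N_H(t) − N_{H₀}(t)| ≤ rank(H − H₀). -/
open Matrix

section

variable {n : ℕ} {A B : Matrix (Fin n) (Fin n) ℂ}

open scoped InnerProductSpace

theorem Matrix.IsHermitian.inner_eigenvectorBasis_toEuclideanLin (hA : A.IsHermitian)
    (i : Fin n) (x : EuclideanSpace ℂ (Fin n)) :
    ⟪hA.eigenvectorBasis i, A.toEuclideanLin x⟫_ℂ =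
      hA.eigenvalues i * ⟪hA.eigenvectorBasis i, x⟫_ℂ := by
  have hsymm := isSymmetric_toEuclideanLin_iff.mpr hA
  have heig : A.toEuclideanLin (hA.eigenvectorBasis i) =
      (hA.eigenvalues i : ℂ) • hA.eigenvectorBasis i := by
    ext j
    simpa using congrFun (hA.mulVec_eigenvectorBasis i) j
  rw [← hsymm, heig, inner_smul_left, Complex.conj_ofReal]

theorem Matrix.IsHermitian.re_inner_toEuclideanLin_sub (hA : A.IsHermitian) (t : ℝ)
    (x : EuclideanSpace ℂ (Fin n)) :
    (⟪x, A.toEuclideanLin x⟫_ℂ).re - t * ‖x‖ ^ 2 =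
      ∑ i, (hA.eigenvalues i - t) * ‖⟪hA.eigenvectorBasis i, x⟫_ℂ‖ ^ 2 := by
  rw [← hA.eigenvectorBasis.sum_sq_norm_inner_right x,
    ← hA.eigenvectorBasis.sum_inner_mul_inner x, Complex.re_sum, Finset.mul_sum,
    ← Finset.sum_sub_distrib]
  refine Finset.sum_congr rfl fun i _ => ?_
  rw [hA.inner_eigenvectorBasis_toEuclideanLin, mul_left_comm,
    ← inner_conj_symm x (hA.eigenvectorBasis i), Complex.conj_mul', ← Complex.ofReal_pow,
    ← Complex.ofReal_mul, Complex.ofReal_re]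
  ring

/-- A vector in the spectral subspace of `A` above `t` and in that of `B` at or below `t`,
on which `A` and `B` agree, vanishes. -/
theorem Matrix.IsHermitian.eq_zero_of_inner_eigenvectorBasis_eq_zero (hA : A.IsHermitian)
    (hB : B.IsHermitian) (t : ℝ) {x : EuclideanSpace ℂ (Fin n)}
    (hxA : ∀ i, hA.eigenvalues i ≤ t → ⟪hA.eigenvectorBasis i, x⟫_ℂ = 0)
    (hxB : ∀ i, t < hB.eigenvalues i → ⟪hB.eigenvectorBasis i, x⟫_ℂ = 0)
    (hAB : A.toEuclideanLin x = B.toEuclideanLin x) : x = 0 := by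
  have hnonneg : ∀ i ∈ Finset.univ,
      0 ≤ (hA.eigenvalues i - t) * ‖⟪hA.eigenvectorBasis i, x⟫_ℂ‖ ^ 2 := fun i _ => by
    rcases le_or_gt (hA.eigenvalues i) t with h | h
    · simp [hxA i h]
    · exact mul_nonneg (sub_nonneg.mpr h.le) (sq_nonneg _)
  have hnonpos : ∑ i, (hB.eigenvalues i - t) * ‖⟪hB.eigenvectorBasis i, x⟫_ℂ‖ ^ 2 ≤ 0 := by
    refine Finset.sum_nonpos fun i _ => ?_
    rcases le_or_gt (hB.eigenvalues i) t with h | h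
    · exact mul_nonpos_of_nonpos_of_nonneg (sub_nonpos.mpr h) (sq_nonneg _)
    · simp [hxB i h]
  rw [← hB.re_inner_toEuclideanLin_sub, ← hAB, hA.re_inner_toEuclideanLin_sub] at hnonpos
  have hzero := (Finset.sum_eq_zero_iff_of_nonneg hnonneg).mp
    (hnonpos.antisymm (Finset.sum_nonneg hnonneg))
  refine hA.eigenvectorBasis.repr.map_eq_zero_iff.mp (PiLp.ext fun i => ?_)
  rw [OrthonormalBasis.repr_apply_apply, PiLp.zero_apply]
  rcases le_or_gt (hA.eigenvalues i) t with h | h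
  · exact hxA i h
  · simpa [(sub_pos.mpr h).ne'] using hzero i (Finset.mem_univ i)

theorem countingFunction_le_add_rank_sub (hA : A.IsHermitian) (hB : B.IsHermitian) (t : ℝ) :
    countingFunction hA t ≤ countingFunction hB t + (A - B).rank := by
  let f : EuclideanSpace ℂ (Fin n) →ₗ[ℂ] ({i // ¬ t < hA.eigenvalues i} → ℂ) ×
      ({i // t < hB.eigenvalues i} → ℂ) × LinearMap.range (A - B).toEuclideanLin :=
    (LinearMap.pi fun i => (innerSL ℂ (hA.eigenvectorBasis i.1)).toLinearMap).prod
      ((LinearMap.pi fun i => (innerSL ℂ (hB.eigenvectorBasis i.1)).toLinearMap).prod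
        (A - B).toEuclideanLin.rangeRestrict)
  have hf : Function.Injective f := by
    refine (injective_iff_map_eq_zero f).mpr fun x hx => ?_
    obtain ⟨h₁, h₂, h₃⟩ : _ ∧ _ ∧ _ := by simpa only [Prod.ext_iff] using hx
    refine hA.eq_zero_of_inner_eigenvectorBasis_eq_zero hB t
      (fun i hi => congrFun h₁ ⟨i, not_lt.mpr hi⟩) (fun i hi => congrFun h₂ ⟨i, hi⟩) ?_
    have h : (A - B).toEuclideanLin x = 0 := congrArg Subtype.val h₃
    rwa [map_sub, LinearMap.sub_apply, sub_eq_zero] at h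
  have hle := LinearMap.finrank_le_finrank_of_injective hf
  have hrank : Module.finrank ℂ (LinearMap.range (A - B).toEuclideanLin) = (A - B).rank := by
    rw [toEuclideanLin_eq_toLin_orthonormal]
    exact ((A - B).rank_eq_finrank_range_toLin _ _).symm
  have hcompl := Fintype.card_subtype_compl fun i => t < hA.eigenvalues i
  have hcard := Fintype.card_subtype_le fun i => t < hA.eigenvalues i
  simp only [Module.finrank_prod, Module.finrank_fintype_fun_eq_card, hrank,
    finrank_euclideanSpace] at hle
  simp only [countingFunction, Nat.card_eq_fintype_card]
  omega

end

/-- For Hermitian matrices `H₀, H` one has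
`|N_H(t) − N_{H₀}(t)| ≤ rank(H − H₀)` for every `t ∈ ℝ`. -/
theorem statement7 {n : ℕ} {H₀ H : Matrix (Fin n) (Fin n) ℂ}
    (hH₀ : H₀.IsHermitian) (hH : H.IsHermitian) :
    ∀ t : ℝ, |(countingFunction hH t : ℤ) - (countingFunction hH₀ t : ℤ)|
      ≤ ((H - H₀).rank : ℤ) := by
  intro t
  have h₁ := countingFunction_le_add_rank_sub hH hH₀ t
  have h₂ := countingFunction_le_add_rank_sub hH₀ hH t
  have hrank : (H₀ - H).rank = (H - H₀).rank := by
    simpa using rank_smul_of_mem_nonZeroDivisors (H - H₀)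
      (mem_nonZeroDivisors_of_ne_zero (neg_ne_zero.mpr (one_ne_zero (α := ℂ))))
  rw [abs_le]
  omega
end

section
/- Let H₀ and H be n×n Hermitian complex matrices. Then ∫_ℝ (N_H(t) − N_{H₀}(t)) dt = tr(H − H₀). -/
open MeasureTheory Matrix

theorem indicator_Iio_sub_indicator_Iio (a b t : ℝ) :
    (Set.Iio a).indicator (1 : ℝ → ℝ) t - (Set.Iio b).indicator 1 t =
      (Set.Ico b a).indicator 1 t - (Set.Ico a b).indicator 1 t := by
  simp only [Set.indicator_apply, Set.mem_Iio, Set.mem_Ico, Pi.one_apply]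
  grind

theorem integrable_indicator_Ico_one (a b : ℝ) :
    Integrable ((Set.Ico a b).indicator (1 : ℝ → ℝ)) :=
  (integrable_indicator_iff measurableSet_Ico).2 (integrableOn_const (by simp))

theorem integrable_indicator_Iio_sub (a b : ℝ) :
    Integrable fun t : ℝ ↦ (Set.Iio a).indicator (1 : ℝ → ℝ) t - (Set.Iio b).indicator 1 t := by
  simp only [indicator_Iio_sub_indicator_Iio]
  exact (integrable_indicator_Ico_one b a).sub (integrable_indicator_Ico_one a b)

theorem integral_indicator_Iio_sub (a b : ℝ) :
    ∫ t : ℝ, ((Set.Iio a).indicator (1 : ℝ → ℝ) t - (Set.Iio b).indicator 1 t) = a - b := by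
  simp only [indicator_Iio_sub_indicator_Iio]
  rw [integral_sub (integrable_indicator_Ico_one b a) (integrable_indicator_Ico_one a b),
    integral_indicator_one measurableSet_Ico, integral_indicator_one measurableSet_Ico,
    Real.volume_real_Ico, Real.volume_real_Ico]
  grind

theorem countingFunction_eq_sum_indicator {n : ℕ} {A : Matrix (Fin n) (Fin n) ℂ}
    (hA : A.IsHermitian) (t : ℝ) :
    (countingFunction hA t : ℝ) = ∑ i, (Set.Iio (hA.eigenvalues i)).indicator (1 : ℝ → ℝ) t := by
  classical
  simp [countingFunction, Set.indicator_apply, Fintype.card_subtype]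

/-- Krein's identity `∫ ξ = tr V` in finite dimensions.
For Hermitian matrices `H₀, H`, `∫_ℝ (N_H(t) − N_{H₀}(t)) dt = tr(H − H₀)`. -/
theorem statement9 {n : ℕ} {H₀ H : Matrix (Fin n) (Fin n) ℂ}
    (hH₀ : H₀.IsHermitian) (hH : H.IsHermitian) :
    ((∫ t : ℝ, ((countingFunction hH t : ℝ) - (countingFunction hH₀ t : ℝ)) : ℝ) : ℂ)
      = (H - H₀).trace := by
  simp only [countingFunction_eq_sum_indicator, ← Finset.sum_sub_distrib]
  rw [integral_finsetSum _ fun i _ ↦ integrable_indicator_Iio_sub _ _, trace_sub,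
    hH.trace_eq_sum_eigenvalues, hH₀.trace_eq_sum_eigenvalues]
  simp [integral_indicator_Iio_sub]
end

section
/- Let f : ℝ → ℝ be measurable with ∫_ℝ |f(ν)| (1 + ν²)^{−3/2} dν < ∞, and let z < 0 be real. Then ∫₀^∞ (λ − z)^{−2} [(1/π) ∫_{−√λ}^{√λ} f(ν) (λ − ν²)^{−1/2} dν] dλ = (1/2) ∫_ℝ f(ν) (ν² − z)^{−3/2} dν, where the inner integral is absolutely convergent for almost every λ > 0 and both outer integrals are absolutely convergent. -/
open MeasureTheory Set

/-- An antiderivative of `λ ↦ (λ - z)⁻² (λ - a)^{-1/2}` on `λ > a`, with `c = a - z`. -/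
lemma hasDerivAt_abel_antideriv {a z x : ℝ} (hz : z < a) (hx : a < x) :
    HasDerivAt (fun t => √(t - a) / ((a - z) * (t - z)) +
        Real.arctan (√(t - a) / √(a - z)) / ((a - z) * √(a - z)))
      (1 / (x - z) ^ 2 * (1 / √(x - a))) x := by
  have hs : 0 < √(x - a) := Real.sqrt_pos.2 (by linarith)
  have hr : 0 < √(a - z) := Real.sqrt_pos.2 (by linarith)
  have hs2 : √(x - a) ^ 2 = x - a := Real.sq_sqrt (by linarith)
  have hr2 : √(a - z) ^ 2 = a - z := Real.sq_sqrt (by linarith)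
  have hsd : HasDerivAt (fun t => √(t - a)) (1 / (2 * √(x - a))) x :=
    ((hasDerivAt_id x).sub_const a).sqrt (by simp; linarith)
  have hd : HasDerivAt (fun t => (a - z) * (t - z)) ((a - z) * 1) x :=
    ((hasDerivAt_id x).sub_const z).const_mul (a - z)
  have hc : 0 < a - z := by linarith
  have hxz : 0 < x - z := by linarith
  have key := (hsd.div hd (mul_pos hc hxz).ne').add
    (((hsd.div_const (√(a - z))).arctan).div_const ((a - z) * √(a - z)))
  refine key.congr_deriv ?_
  have e1 : x - z = √(x - a) ^ 2 + √(a - z) ^ 2 := by rw [hs2, hr2]; ring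
  rw [e1, ← hr2, Real.sqrt_sq hr.le]
  generalize √(x - a) = s at *
  generalize √(a - z) = r at *
  have : 0 < s ^ 2 + r ^ 2 := by positivity
  have : 0 < r ^ 2 + s ^ 2 := by positivity
  field_simp
  ring

lemma tendsto_abel_antideriv {a z : ℝ} (hz : z < a) :
    Filter.Tendsto (fun t => √(t - a) / ((a - z) * (t - z)) +
        Real.arctan (√(t - a) / √(a - z)) / ((a - z) * √(a - z)))
      Filter.atTop (nhds (Real.pi / 2 * (a - z) ^ (-(3/2) : ℝ))) := by
  have hc : 0 < a - z := by linarith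
  have hr : 0 < √(a - z) := Real.sqrt_pos.2 hc
  have hs : Filter.Tendsto (fun t => √(t - a)) Filter.atTop Filter.atTop :=
    Real.tendsto_sqrt_atTop.comp (Filter.tendsto_atTop_add_const_right _ (-a) Filter.tendsto_id)
  have h1 : Filter.Tendsto (fun t => √(t - a) / ((a - z) * (t - z))) Filter.atTop (nhds 0) := by
    have hinv : Filter.Tendsto (fun t => (1 / (a - z)) * (√(t - a))⁻¹) Filter.atTop (nhds 0) := by
      simpa using (tendsto_inv_atTop_zero.comp hs).const_mul (1 / (a - z))
    refine squeeze_zero' ?_ ?_ hinv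
    · filter_upwards [Filter.eventually_gt_atTop a] with t ht
      have : 0 < t - z := by linarith
      positivity
    · filter_upwards [Filter.eventually_gt_atTop a] with t ht
      have h0 : 0 < √(t - a) := Real.sqrt_pos.2 (by linarith)
      have hs2 : √(t - a) * √(t - a) = t - a := Real.mul_self_sqrt (by linarith)
      have : 0 < t - z := by linarith
      rw [← one_div, one_div_mul_one_div, div_le_div_iff₀ (by positivity) (by positivity)]
      nlinarith
  have h2 : Filter.Tendsto (fun t => Real.arctan (√(t - a) / √(a - z))) Filter.atTop
      (nhds (Real.pi / 2)) :=
    ((Real.tendsto_arctan_atTop).mono_right nhdsWithin_le_nhds).comp (hs.atTop_div_const hr)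
  have h3 := h1.add (h2.div_const ((a - z) * √(a - z)))
  have e : (a - z) ^ (-(3/2) : ℝ) = ((a - z) * √(a - z))⁻¹ := by
    rw [Real.rpow_neg hc.le, Real.sqrt_eq_rpow]
    congr 1
    nth_rewrite 2 [← Real.rpow_one (a - z)]
    rw [← Real.rpow_add hc]
    norm_num
  rwa [zero_add, div_eq_mul_inv, ← e] at h3

lemma continuousWithinAt_abel_antideriv {a z : ℝ} (hz : z < a) :
    ContinuousWithinAt (fun t => √(t - a) / ((a - z) * (t - z)) +
        Real.arctan (√(t - a) / √(a - z)) / ((a - z) * √(a - z))) (Ici a) a := by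
  have hc : (a - z) * (a - z) ≠ 0 := by
    have : a - z ≠ 0 := by linarith
    positivity
  refine ContinuousAt.continuousWithinAt (ContinuousAt.add (ContinuousAt.div ?_ ?_ hc) ?_)
  · fun_prop
  · fun_prop
  · exact (Real.continuous_arctan.comp
      ((by fun_prop : Continuous fun t : ℝ => √(t - a)).div_const _)).continuousAt.div_const _

lemma integrableOn_Ioi_abel_kernel {a z : ℝ} (hz : z < a) :
    IntegrableOn (fun x => 1 / (x - z) ^ 2 * (1 / √(x - a))) (Ioi a) :=
  integrableOn_Ioi_deriv_of_nonneg (continuousWithinAt_abel_antideriv hz)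
    (fun _ hx => hasDerivAt_abel_antideriv hz hx) (fun _ _ => by positivity)
    (tendsto_abel_antideriv hz)

lemma integral_Ioi_abel_kernel {a z : ℝ} (hz : z < a) :
    ∫ x in Ioi a, 1 / (x - z) ^ 2 * (1 / √(x - a)) = Real.pi / 2 * (a - z) ^ (-(3/2) : ℝ) := by
  rw [integral_Ioi_of_hasDerivAt_of_nonneg (continuousWithinAt_abel_antideriv hz)
    (fun _ hx => hasDerivAt_abel_antideriv hz hx) (fun _ _ => by positivity)
    (tendsto_abel_antideriv hz)]
  simp

lemma abel_kernel_eq_zero_of_le {a z x : ℝ} (hx : x ≤ a) :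
    1 / (x - z) ^ 2 * (1 / √(x - a)) = 0 := by
  simp [Real.sqrt_eq_zero_of_nonpos (sub_nonpos.2 hx)]

lemma integrableOn_Ioi_zero_abel_kernel {a z : ℝ} (hz : z < a) :
    IntegrableOn (fun x => 1 / (x - z) ^ 2 * (1 / √(x - a))) (Ioi 0) :=
  (integrableOn_Ioi_abel_kernel hz).of_forall_sdiff_eq_zero measurableSet_Ioi
    fun _ hx => abel_kernel_eq_zero_of_le (not_lt.1 hx.2)

lemma integral_Ioi_zero_abel_kernel {a z : ℝ} (ha : 0 ≤ a) (hz : z < a) :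
    ∫ x in Ioi 0, 1 / (x - z) ^ 2 * (1 / √(x - a)) =
      Real.pi / 2 * (a - z) ^ (-(3/2) : ℝ) := by
  rw [← integral_Ioi_abel_kernel hz]
  exact setIntegral_eq_of_subset_of_forall_sdiff_eq_zero measurableSet_Ioi
    (Ioi_subset_Ioi ha) fun _ hx => abel_kernel_eq_zero_of_le (not_lt.1 hx.2)

lemma integrable_mul_rpow_sq_sub {f : ℝ → ℝ} (hf : Measurable f)
    (hint : Integrable (fun ν : ℝ => |f ν| * (1 + ν ^ 2) ^ (-(3/2) : ℝ))) {z : ℝ} (hz : z < 0) :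
    Integrable (fun ν : ℝ => f ν * (ν ^ 2 - z) ^ (-(3/2) : ℝ)) := by
  have hm : 0 < min 1 (-z) := lt_min one_pos (neg_pos.2 hz)
  refine (hint.const_mul ((min 1 (-z)) ^ (-(3/2) : ℝ))).mono'
    (Measurable.aestronglyMeasurable (by fun_prop)) (Filter.Eventually.of_forall fun ν => ?_)
  have hp : 0 < ν ^ 2 - z := by nlinarith [sq_nonneg ν]
  rw [norm_mul, Real.norm_eq_abs, Real.norm_eq_abs, abs_of_nonneg (Real.rpow_nonneg hp.le _),
    mul_left_comm, ← Real.mul_rpow hm.le (by positivity)]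
  refine mul_le_mul_of_nonneg_left (Real.rpow_le_rpow_of_nonpos (by positivity) ?_ (by norm_num))
    (abs_nonneg _)
  nlinarith [min_le_left 1 (-z), min_le_right 1 (-z), sq_nonneg ν]

lemma integrable_prod_abel_kernel {f : ℝ → ℝ} (hf : Measurable f) {z : ℝ} (hz : z < 0)
    (hint : Integrable (fun ν : ℝ => f ν * (ν ^ 2 - z) ^ (-(3/2) : ℝ))) :
    Integrable (fun p : ℝ × ℝ => 1 / (p.1 - z) ^ 2 * (f p.2 / √(p.1 - p.2 ^ 2)))
      ((volume.restrict (Ioi 0)).prod volume) := by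
  have hzν (ν : ℝ) : z < ν ^ 2 := hz.trans_le (sq_nonneg ν)
  rw [integrable_prod_iff' (Measurable.aestronglyMeasurable (by fun_prop))]
  constructor
  · refine Filter.Eventually.of_forall fun ν => ?_
    convert (integrableOn_Ioi_zero_abel_kernel (hzν ν)).const_mul (f ν) using 2
    ring
  · refine (hint.norm.const_mul (Real.pi / 2)).congr (Filter.Eventually.of_forall fun ν => ?_)
    have h (x : ℝ) : ‖1 / (x - z) ^ 2 * (f ν / √(x - ν ^ 2))‖ =
        |f ν| * (1 / (x - z) ^ 2 * (1 / √(x - ν ^ 2))) := by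
      rw [norm_mul, norm_div (f ν), Real.norm_of_nonneg (Real.sqrt_nonneg _),
        Real.norm_of_nonneg (by positivity : 0 ≤ 1 / (x - z) ^ 2), Real.norm_eq_abs]
      ring
    simp only [h]
    rw [integral_const_mul, integral_Ioi_zero_abel_kernel (sq_nonneg ν) (hzν ν), norm_mul,
      Real.norm_of_nonneg (Real.rpow_nonneg (sub_pos.2 (hzν ν)).le _), Real.norm_eq_abs]
    ring

lemma intervalIntegral_div_sqrt_sub_sq (f : ℝ → ℝ) (x : ℝ) :
    ∫ ν in (-√x)..√x, f ν / √(x - ν ^ 2) = ∫ ν, f ν / √(x - ν ^ 2) := by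
  rw [intervalIntegral.integral_of_le (by linarith [Real.sqrt_nonneg x])]
  refine setIntegral_eq_integral_of_forall_compl_eq_zero fun ν hν => ?_
  rw [Real.sqrt_eq_zero_of_nonpos, div_zero]
  by_contra! h
  have h' := abs_lt.1 ((Real.lt_sqrt (abs_nonneg ν)).2 ((sq_abs ν).trans_lt (sub_pos.1 h)))
  exact hν ⟨h'.1, h'.2.le⟩

/-- consistency of Pushnitski's formula with the principal trace
formula. For measurable `f` with `∫ |f(ν)| (1+ν²)^{-3/2} dν < ∞` and real `z < 0`:
the inner Abel-type integral is absolutely convergent for a.e. `λ > 0`, both outer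
integrals are absolutely convergent, and
`∫₀^∞ (λ−z)^{-2} [(1/π) ∫_{−√λ}^{√λ} f(ν)(λ−ν²)^{-1/2} dν] dλ
  = (1/2) ∫_ℝ f(ν) (ν²−z)^{-3/2} dν`. -/
theorem statement13 (f : ℝ → ℝ) (hf : Measurable f)
    (hint : Integrable (fun ν : ℝ => |f ν| * (1 + ν ^ 2) ^ (-(3/2) : ℝ)))
    (z : ℝ) (hz : z < 0) :
    (∀ᵐ lam ∂(volume.restrict (Set.Ioi (0:ℝ))),
        IntegrableOn (fun ν => f ν / Real.sqrt (lam - ν ^ 2))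
          (Set.Ioo (-Real.sqrt lam) (Real.sqrt lam))) ∧
    IntegrableOn (fun lam : ℝ =>
        (1 / (lam - z) ^ 2) *
          ((1 / Real.pi) *
            ∫ ν in (-Real.sqrt lam)..Real.sqrt lam, f ν / Real.sqrt (lam - ν ^ 2)))
      (Set.Ioi 0) ∧
    Integrable (fun ν : ℝ => f ν * (ν ^ 2 - z) ^ (-(3/2) : ℝ)) ∧
    ∫ lam in Set.Ioi (0:ℝ),
        (1 / (lam - z) ^ 2) *
          ((1 / Real.pi) *
            ∫ ν in (-Real.sqrt lam)..Real.sqrt lam, f ν / Real.sqrt (lam - ν ^ 2))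
      = (1/2) * ∫ ν : ℝ, f ν * (ν ^ 2 - z) ^ (-(3/2) : ℝ) := by
  have hI := integrable_mul_rpow_sq_sub hf hint hz
  have hP := integrable_prod_abel_kernel hf hz hI
  have hG : (fun lam : ℝ => (1 / (lam - z) ^ 2) * ((1 / Real.pi) *
      ∫ ν in (-Real.sqrt lam)..Real.sqrt lam, f ν / Real.sqrt (lam - ν ^ 2))) =
      fun lam => (1 / Real.pi) * ∫ ν, 1 / (lam - z) ^ 2 * (f ν / √(lam - ν ^ 2)) := by
    ext lam
    rw [intervalIntegral_div_sqrt_sub_sq, integral_const_mul]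
    ring
  refine ⟨?_, ?_, hI, ?_⟩
  · filter_upwards [hP.prod_right_ae, ae_restrict_mem measurableSet_Ioi] with lam h hlam
    have hne : (1 : ℝ) / (lam - z) ^ 2 ≠ 0 := by
      have : 0 < lam - z := by linarith [mem_Ioi.1 hlam]
      positivity
    exact ((integrable_const_mul_iff hne.isUnit _).1 h).integrableOn
  · rw [hG]
    exact hP.integral_prod_left.const_mul _
  · rw [hG, integral_const_mul, integral_integral_swap hP]
    have h (ν : ℝ) : ∫ lam in Ioi 0, 1 / (lam - z) ^ 2 * (f ν / √(lam - ν ^ 2)) =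
        Real.pi / 2 * (f ν * (ν ^ 2 - z) ^ (-(3/2) : ℝ)) := by
      rw [mul_left_comm, ← integral_Ioi_zero_abel_kernel (sq_nonneg ν)
        (hz.trans_le (sq_nonneg ν)), ← integral_const_mul]
      congr 1 with lam
      ring
    simp only [h]
    rw [integral_const_mul]
    field_simp
end

section
/- Let H₀ and H be n×n Hermitian complex matrices and let V = H − H₀. If V has exactly k₊ strictly positive eigenvalues and exactly k₋ strictly negative eigenvalues (counted with multiplicity), then for all t ∈ ℝ, −k₋ ≤ N_H(t) − N_{H₀}(t) ≤ k₊. -/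
open Matrix

/-- The quadratic form of a Hermitian matrix in the coordinates of its eigenvector basis. -/
lemma Matrix.IsHermitian.inner_toEuclideanLin_eq_sum {𝕜 ι : Type*} [RCLike 𝕜] [Fintype ι]
    [DecidableEq ι] {A : Matrix ι ι 𝕜} (hA : A.IsHermitian) (x : EuclideanSpace 𝕜 ι) :
    RCLike.re (inner 𝕜 x (A.toEuclideanLin x)) =
      ∑ i, hA.eigenvalues i * ‖hA.eigenvectorBasis.repr x i‖ ^ 2 := by
  have hb (i : ι) : A.toEuclideanLin (hA.eigenvectorBasis i) =
      (hA.eigenvalues i : 𝕜) • hA.eigenvectorBasis i := by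
    ext j
    have h := congrFun (hA.mulVec_eigenvectorBasis i) j
    simpa [Matrix.toLpLin_apply, RCLike.real_smul_eq_coe_mul] using h
  rw [← hA.eigenvectorBasis.sum_inner_mul_inner, map_sum]
  refine Finset.sum_congr rfl fun i _ => ?_
  rw [← Matrix.isSymmetric_toEuclideanLin_iff.mpr hA, hb, inner_smul_left, RCLike.conj_ofReal,
    mul_left_comm, RCLike.re_ofReal_mul, inner_mul_symm_re_eq_norm, norm_mul,
    norm_inner_symm x, ← sq, OrthonormalBasis.repr_apply_apply]

/-- If a diagonal quadratic form is a sum of two others, each diagonal in its own orthonormal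
basis, then its number of coefficients above `t` is at most the number of coefficients of the
first summand above `t` plus the number of positive coefficients of the second. -/
lemma card_lt_le_card_lt_add_card_pos {𝕜 E ι : Type*} [RCLike 𝕜] [NormedAddCommGroup E]
    [InnerProductSpace 𝕜 E] [Fintype ι] (b c d : OrthonormalBasis ι 𝕜 E) (l m v : ι → ℝ)
    (h : ∀ x, ∑ i, l i * ‖b.repr x i‖ ^ 2 =
      ∑ i, m i * ‖c.repr x i‖ ^ 2 + ∑ i, v i * ‖d.repr x i‖ ^ 2) (t : ℝ) :
    Nat.card {i // t < l i} ≤ Nat.card {i // t < m i} + Nat.card {i // 0 < v i} := by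
  classical
  let coords (e : OrthonormalBasis ι 𝕜 E) (p : ι → Prop) : E →ₗ[𝕜] ({i // p i} → 𝕜) :=
    LinearMap.funLeft 𝕜 𝕜 Subtype.val ∘ₗ e.toBasis.equivFun.toLinearMap
  have coords_eq_zero {e : OrthonormalBasis ι 𝕜 E} {p : ι → Prop} {x : E}
      (hx : coords e p x = 0) (i : ι) (hi : p i) : e.repr x i = 0 := by
    simpa [coords, LinearMap.funLeft_apply] using congrFun hx ⟨i, hi⟩
  let f := (coords b fun i => ¬ t < l i).prod
    ((coords c fun i => t < m i).prod (coords d fun i => 0 < v i))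
  have hf : Function.Injective f := by
    rw [injective_iff_map_eq_zero]
    intro x hx
    obtain ⟨hb, hcd⟩ := Prod.mk.inj hx
    obtain ⟨hc, hd⟩ := Prod.mk.inj hcd
    replace hb := coords_eq_zero hb
    replace hc := coords_eq_zero hc
    replace hd := coords_eq_zero hd
    have norm_sq (e : OrthonormalBasis ι 𝕜 E) : ∑ i, ‖e.repr x i‖ ^ 2 = ‖x‖ ^ 2 := by
      simp [e.repr_apply_apply, e.sum_sq_norm_inner_right]
    have hnonneg (i : ι) : 0 ≤ (l i - t) * ‖b.repr x i‖ ^ 2 := by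
      by_cases hi : t < l i
      · have := sub_pos.mpr hi
        positivity
      · simp [hb i hi]
    have hm : ∑ i, (m i - t) * ‖c.repr x i‖ ^ 2 ≤ 0 := Finset.sum_nonpos fun i _ => by
      by_cases hi : t < m i
      · simp [hc i hi]
      · exact mul_nonpos_of_nonpos_of_nonneg (by linarith) (by positivity)
    have hv : ∑ i, v i * ‖d.repr x i‖ ^ 2 ≤ 0 := Finset.sum_nonpos fun i _ => by
      by_cases hi : 0 < v i
      · simp [hd i hi]
      · exact mul_nonpos_of_nonpos_of_nonneg (by linarith) (by positivity)
    have hsum : ∑ i, (l i - t) * ‖b.repr x i‖ ^ 2 = 0 := by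
      refine le_antisymm ?_ (Finset.sum_nonneg fun i _ => hnonneg i)
      simp only [sub_mul, Finset.sum_sub_distrib, ← Finset.mul_sum, norm_sq] at hm ⊢
      linarith [h x]
    rw [Finset.sum_eq_zero_iff_of_nonneg fun i _ => hnonneg i] at hsum
    refine b.repr.map_eq_zero_iff.mp (PiLp.ext fun i => ?_)
    by_cases hi : t < l i
    · simpa [(sub_pos.mpr hi).ne'] using hsum i (Finset.mem_univ i)
    · exact hb i hi
  have hdim := LinearMap.finrank_le_finrank_of_injective hf
  simp only [Module.finrank_prod, Module.finrank_fintype_fun_eq_card,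
    Module.finrank_eq_card_basis b.toBasis, Fintype.card_subtype_compl] at hdim
  have := Fintype.card_subtype_le fun i => t < l i
  simp only [Nat.card_eq_fintype_card]
  omega

/-- Krein's bound via the signature of the perturbation, finite
dimensions. If `V = H − H₀` has exactly `k₊` strictly positive and `k₋` strictly
negative eigenvalues, then `−k₋ ≤ N_H(t) − N_{H₀}(t) ≤ k₊` for all `t ∈ ℝ`. -/
theorem statement15 {n : ℕ} {H₀ H : Matrix (Fin n) (Fin n) ℂ}
    (hH₀ : H₀.IsHermitian) (hH : H.IsHermitian) (kplus kminus : ℕ)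
    (hkplus : Nat.card {i : Fin n // 0 < (hH.sub hH₀).eigenvalues i} = kplus)
    (hkminus : Nat.card {i : Fin n // (hH.sub hH₀).eigenvalues i < 0} = kminus) :
    ∀ t : ℝ,
      -(kminus : ℤ) ≤ (countingFunction hH t : ℤ) - (countingFunction hH₀ t : ℤ) ∧
      (countingFunction hH t : ℤ) - (countingFunction hH₀ t : ℤ) ≤ (kplus : ℤ) := by
  intro t
  have hsub (x : EuclideanSpace ℂ (Fin n)) :
      ∑ i, (hH.sub hH₀).eigenvalues i * ‖(hH.sub hH₀).eigenvectorBasis.repr x i‖ ^ 2 =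
        ∑ i, hH.eigenvalues i * ‖hH.eigenvectorBasis.repr x i‖ ^ 2 -
          ∑ i, hH₀.eigenvalues i * ‖hH₀.eigenvectorBasis.repr x i‖ ^ 2 := by
    simp only [← Matrix.IsHermitian.inner_toEuclideanLin_eq_sum, map_sub, LinearMap.sub_apply,
      inner_sub_right]
  have hupper := card_lt_le_card_lt_add_card_pos hH.eigenvectorBasis hH₀.eigenvectorBasis
    (hH.sub hH₀).eigenvectorBasis hH.eigenvalues hH₀.eigenvalues (hH.sub hH₀).eigenvalues
    (fun x => by linarith [hsub x]) t
  have hlower := card_lt_le_card_lt_add_card_pos hH₀.eigenvectorBasis hH.eigenvectorBasis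
    (hH.sub hH₀).eigenvectorBasis hH₀.eigenvalues hH.eigenvalues
    (fun i => -(hH.sub hH₀).eigenvalues i)
    (fun x => by
      simp only [neg_mul, Finset.sum_neg_distrib]
      linarith [hsub x]) t
  simp only [neg_pos] at hlower
  unfold countingFunction
  omega
end
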